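/- arXiv:1910.08025 — 5 statements merged into one kernel-verified Lean document; each statement's English description precedes it below -/
import Mathlib

section
/- There is a universal constant c > 0 such that the following holds. Let G be a graph on n ≥ 2 vertices, let A and B be disjoint subsets of V(G) with |A| ≤ |B| and |A| = N, let z ≥ 1 be an integer, and let 0 < ψ < 1/2. Then at least one of the following holds: (1) there is a matching M ⊆ A × B (a set of pairs (a,b) with a ∈ A, b ∈ B, no vertex in more than one pair) with |M| > N − z, together with, for every pair (a,b) ∈ M, a path P(a,b) in G from a to b, such that every edge of G lies on at most c·(log₂ n)/ψ of these paths; or (2) there is a partition (X,Y) of V(G) with |X| ≥ z/2, |Y| ≥ z/2 and Ψ_G(X,Y) ≤ ψ. -/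
open Finset
open scoped Classical

variable {V : Type*}

/-- The number of edges of `G` with one endpoint in `A` and the other in `B`
(for disjoint `A`, `B`). -/
noncomputable def interEdges (G : SimpleGraph V) (A B : Finset V) : ℕ :=
  ((A ×ˢ B).filter fun p => G.Adj p.1 p.2).card

namespace MatchOrCut

/-- An integral flow on `G` in which every edge has capacity `k`. -/
structure IsFlow (G : SimpleGraph V) (k : ℕ) (f : V → V → ℤ) : Prop where
  antisymm : ∀ u v, f u v = -f v u
  le_cap : ∀ u v, f u v ≤ if G.Adj u v then (k : ℤ) else 0

/-- The net flow out of `v`. -/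
def out [Fintype V] (f : V → V → ℤ) (v : V) : ℤ := ∑ w, f v w

/-- Add one unit of flow from `a` to `w`. -/
def push [DecidableEq V] (f : V → V → ℤ) (a w : V) (x y : V) : ℤ :=
  f x y + (if x = a ∧ y = w then 1 else 0) - (if x = w ∧ y = a then 1 else 0)

theorem IsFlow.adj_of_pos {G : SimpleGraph V} {k : ℕ} {f : V → V → ℤ} (hf : IsFlow G k f)
    {u v : V} (h : 0 < f u v) : G.Adj u v := by
  by_contra hn
  have := hf.le_cap u v
  rw [if_neg hn] at this
  omega

theorem out_push [Fintype V] [DecidableEq V] (f : V → V → ℤ) (a w v : V) :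
    out (push f a w) v = out f v + (if v = a then 1 else 0) - (if v = w then 1 else 0) := by
  simp [out, push, Finset.sum_add_distrib, ite_and]

theorem IsFlow.push [DecidableEq V] {G : SimpleGraph V} {k : ℕ} {f : V → V → ℤ}
    (hf : IsFlow G k f) {a w : V} (hadj : G.Adj a w) (h : f a w < k) :
    IsFlow G k (push f a w) := by
  refine ⟨fun u v => ?_, fun u v => ?_⟩
  · have := hf.antisymm u v
    simp only [MatchOrCut.push, and_comm (a := v = a), and_comm (a := v = w)]
    omega
  · have h1 := hf.le_cap u v
    by_cases huv : u = a ∧ v = w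
    · obtain ⟨rfl, rfl⟩ := huv
      simp only [MatchOrCut.push, if_pos hadj, and_self, if_true]
      split_ifs <;> omega
    · simp only [MatchOrCut.push, if_neg huv]
      split_ifs at h1 ⊢ <;> omega

theorem sum_out_eq [Fintype V] [DecidableEq V] {f : V → V → ℤ} (hf : ∀ u v, f u v = -f v u)
    (S : Finset V) : ∑ v ∈ S, out f v = ∑ v ∈ S, ∑ w ∈ Sᶜ, f v w := by
  have h0 : ∑ v ∈ S, ∑ w ∈ S, f v w = 0 := by
    have h : ∑ v ∈ S, ∑ w ∈ S, f v w = -∑ v ∈ S, ∑ w ∈ S, f v w := by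
      conv_lhs => rw [Finset.sum_comm]
      simp only [← Finset.sum_neg_distrib]
      exact Finset.sum_congr rfl fun v _ => Finset.sum_congr rfl fun w _ => hf w v
    omega
  calc ∑ v ∈ S, out f v = ∑ v ∈ S, (∑ w ∈ S, f v w + ∑ w ∈ Sᶜ, f v w) :=
        Finset.sum_congr rfl fun v _ => (Finset.sum_add_sum_compl S _).symm
    _ = _ := by rw [Finset.sum_add_distrib, h0, zero_add]

theorem sum_out [Fintype V] [DecidableEq V] {f : V → V → ℤ} (hf : ∀ u v, f u v = -f v u) :
    ∑ v, out f v = 0 := by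
  simpa using sum_out_eq hf Finset.univ

/-- Pushing a unit of flow along a path of the residual graph. -/
theorem exists_augment [Fintype V] [DecidableEq V] {G : SimpleGraph V} {k : ℕ} {a b : V}
    (p : G.Walk a b) : ∀ {f : V → V → ℤ}, IsFlow G k f → p.IsPath →
      (∀ d ∈ p.darts, f d.fst d.snd < k) →
      ∃ f', IsFlow G k f' ∧
        ∀ v, out f' v = out f v + (if v = a then 1 else 0) - (if v = b then 1 else 0) := by
  induction p with
  | nil => exact fun {f} hf _ _ => ⟨f, hf, fun v => by ring⟩
  | @cons a w b h p ih =>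
    intro f hf hp hd
    rw [SimpleGraph.Walk.cons_isPath_iff] at hp
    have h0 : f a w < k := hd ⟨(a, w), h⟩ (by simp)
    obtain ⟨f', hf', ho⟩ := ih (hf.push h h0) hp.1 (by
      intro d hdp
      have h1 := hd d (by simp [hdp])
      have h2 : d.fst ≠ a := fun e => hp.2 (e ▸ p.dart_fst_mem_support_of_mem_darts hdp)
      simp only [push, h2, false_and, if_false]
      split_ifs <;> omega)
    refine ⟨f', hf', fun v => ?_⟩
    rw [ho, out_push]
    ring

/-- Integral max-flow min-cut: either `m` units can be sent from `A` to `B`, with at most one unit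
per vertex of `A` and of `B`, or there is a cut of capacity less than `m`. -/
theorem exists_flow_or_cut [Fintype V] [DecidableEq V] (G : SimpleGraph V) (k : ℕ)
    (A B : Finset V) (m : ℕ) :
    (∃ A' ⊆ A, ∃ B' ⊆ B, ∃ f, IsFlow G k f ∧ A'.card = m ∧
      ∀ v, out f v = (if v ∈ A' then 1 else 0) - (if v ∈ B' then 1 else 0)) ∨
    ∃ S : Finset V, (A \ S).card + (B ∩ S).card + k * interEdges G S Sᶜ < m := by
  induction m with
  | zero =>
    refine Or.inl ⟨∅, by simp, ∅, by simp, fun _ _ => 0, ⟨by simp, fun u v => ?_⟩, by simp,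
      by simp [out]⟩
    split_ifs <;> omega
  | succ m ih =>
    rcases ih with ⟨A', hA', B', hB', f, hf, hm, ho⟩ | ⟨S, hS⟩
    swap
    · exact Or.inr ⟨S, by omega⟩
    let S : Finset V := Finset.univ.filter fun v =>
      ∃ a ∈ A \ A', ∃ p : G.Walk a v, ∀ d ∈ p.darts, f d.fst d.snd < k
    by_cases hb : ∃ b ∈ B \ B', b ∈ S
    · left
      obtain ⟨b, hbB, hbS⟩ := hb
      obtain ⟨a, ha, p, hp⟩ := (Finset.mem_filter.mp hbS).2
      rw [Finset.mem_sdiff] at ha hbB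
      obtain ⟨f', hf', ho'⟩ := exists_augment p.bypass hf p.bypass_isPath
        (fun d hd => hp d (p.darts_bypass_subset_darts hd))
      refine ⟨insert a A', Finset.insert_subset ha.1 hA', insert b B',
        Finset.insert_subset hbB.1 hB', f', hf', by rw [Finset.card_insert_of_notMem ha.2, hm],
        fun v => ?_⟩
      rw [ho', ho]
      have h1 : v = a → v ∉ A' := fun e => e ▸ ha.2
      have h2 : v = b → v ∉ B' := fun e => e ▸ hbB.2
      simp only [Finset.mem_insert]
      by_cases e1 : v = a <;> by_cases e2 : v = b <;> (simp_all; try ring)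
    · right
      refine ⟨S, ?_⟩
      have hAS : A \ S = A' \ S := by
        ext v
        simp only [Finset.mem_sdiff]
        refine ⟨fun h => ⟨?_, h.2⟩, fun h => ⟨hA' h.1, h.2⟩⟩
        by_contra hv
        exact h.2 (Finset.mem_filter.mpr ⟨Finset.mem_univ _, v, Finset.mem_sdiff.mpr ⟨h.1, hv⟩,
          .nil, by simp⟩)
      have hBS : B ∩ S = B' ∩ S := by
        ext v
        simp only [Finset.mem_inter]
        refine ⟨fun h => ⟨?_, h.2⟩, fun h => ⟨hB' h.1, h.2⟩⟩
        by_contra hv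
        exact hb ⟨v, Finset.mem_sdiff.mpr ⟨h.1, hv⟩, h.2⟩
      have hsat : ∀ v ∈ S, ∀ w ∈ Sᶜ, f v w = if G.Adj v w then (k : ℤ) else 0 := by
        intro v hv w hw
        refine le_antisymm (hf.le_cap v w) ?_
        split_ifs with hadj
        · by_contra hlt
          obtain ⟨a, ha, p, hp⟩ := (Finset.mem_filter.mp hv).2
          refine (Finset.mem_compl.mp hw) (Finset.mem_filter.mpr ⟨Finset.mem_univ _, a, ha,
            p.concat hadj, fun d hd => ?_⟩)
          rw [SimpleGraph.Walk.darts_concat, List.concat_eq_append, List.mem_append,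
            List.mem_singleton] at hd
          rcases hd with hd | rfl
          · exact hp d hd
          · simpa using hlt
        · have h1 := hf.le_cap w v
          rw [if_neg fun h => hadj h.symm] at h1
          have := hf.antisymm v w
          omega
      have h1 : ∑ v ∈ S, out f v = k * interEdges G S Sᶜ := by
        rw [sum_out_eq hf.antisymm, Finset.sum_congr rfl fun v hv =>
          Finset.sum_congr rfl (hsat v hv), ← Finset.sum_product', interEdges, Finset.card_filter]
        push_cast
        rw [Finset.mul_sum]
        exact Finset.sum_congr rfl fun p _ => by simp
      have h2 : ∑ v ∈ S, out f v = ((A' ∩ S).card : ℤ) - (B' ∩ S).card := by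
        simp only [ho, Finset.sum_sub_distrib, Finset.sum_boole, Finset.filter_mem_eq_inter,
          Finset.inter_comm S]
      have h3 := Finset.card_sdiff_add_card_inter A' S
      rw [hAS, hBS]
      zify at h3 hm ⊢
      linarith

/-- Decomposition of an integral flow into walks from its sources to its sinks. -/
theorem exists_walks [Fintype V] [DecidableEq V] {G : SimpleGraph V} {k : ℕ} {ι : Type*}
    [Fintype ι] [DecidableEq ι] (t : ι → V) (n : ℕ) : ∀ (s : ι → V) (f : V → V → ℤ), IsFlow G k f →
      ∑ u, ∑ v, (f u v).natAbs = n →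
      (∀ v, out f v = ((Finset.univ.filter fun i => s i = v).card : ℤ) -
        (Finset.univ.filter fun i => t i = v).card) →
      ∃ (σ : Equiv.Perm ι) (W : ∀ i, G.Walk (s i) (t (σ i))),
        ∀ a b, (∑ i, if s(a, b) ∈ (W i).edges then 1 else 0) ≤ (f a b).natAbs := by
  induction n using Nat.strong_induction_on with
  | _ n ih =>
  intro s f hf hn ho
  by_cases h0 : ∀ v, out f v ≤ 0
  · have h1 : ∀ v, out f v = 0 := fun v =>
      (Finset.sum_eq_zero_iff_of_nonpos fun v _ => h0 v).mp (sum_out hf.antisymm) v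
        (Finset.mem_univ v)
    obtain ⟨σ, hσ⟩ : ∃ σ : Equiv.Perm ι, ∀ i, s i = t (σ i) := by
      have e : ∀ v, Nonempty ({i // s i = v} ≃ {i // t i = v}) := fun v => by
        refine ⟨Fintype.equivOfCardEq ?_⟩
        have := h1 v
        rw [ho] at this
        rw [Fintype.card_subtype, Fintype.card_subtype]
        omega
      exact ⟨Equiv.ofFiberEquiv fun v => (e v).some, fun i => (Equiv.ofFiberEquiv_map _ i).symm⟩
    refine ⟨σ, fun i => (SimpleGraph.Walk.nil : G.Walk (s i) (s i)).copy rfl (hσ i),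
      fun a b => ?_⟩
    simp
  · push Not at h0
    obtain ⟨v, hv⟩ := h0
    obtain ⟨u, -, hu⟩ := Finset.exists_lt_of_sum_lt (s := Finset.univ) (f := fun _ : V => (0 : ℤ))
      (g := f v) (by simpa [out] using hv)
    obtain ⟨i, hi⟩ : ∃ i, s i = v := by
      by_contra hne
      push Not at hne
      rw [ho, Finset.filter_false_of_mem fun i _ => hne i] at hv
      simp at hv
      omega
    subst hi
    have hadj := hf.adj_of_pos hu
    have hanti := hf.antisymm (s i) u
    have hne := hadj.ne
    have hle : ∀ x y, (push f u (s i) x y).natAbs +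
        (if (x = s i ∧ y = u) ∨ (x = u ∧ y = s i) then 1 else 0) = (f x y).natAbs := by
      intro x y
      by_cases h1 : x = s i ∧ y = u
      · obtain ⟨rfl, rfl⟩ := h1
        simp only [push, hne, hne.symm, and_self, true_or, if_true, if_false]
        omega
      · by_cases h2 : x = u ∧ y = s i
        · obtain ⟨rfl, rfl⟩ := h2
          simp only [push, hne, hne.symm, and_self, or_true, if_true, if_false]
          omega
        · simp [push, h1, h2]
    have hlt : ∑ x, ∑ y, (push f u (s i) x y).natAbs < n := by
      rw [← hn]
      refine Finset.sum_lt_sum (fun x _ => Finset.sum_le_sum fun y _ => by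
        have := hle x y; omega) ⟨s i, Finset.mem_univ _, Finset.sum_lt_sum (fun y _ => by
        have := hle (s i) y; omega) ⟨u, Finset.mem_univ _, ?_⟩⟩
      have := hle (s i) u
      simp only [and_self, true_or, if_true] at this
      omega
    have hpf : IsFlow G k (push f u (s i)) := hf.push hadj.symm (by omega)
    obtain ⟨σ, W, hW⟩ := ih _ hlt (Function.update s i u) _ hpf rfl (by
      intro v
      rw [out_push, ho]
      have hc : ∀ r : ι → V, ((Finset.univ.filter fun j => r j = v).card : ℤ) =
          (if r i = v then 1 else 0) + ∑ j ∈ Finset.univ.erase i, if r j = v then 1 else 0 := by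
        intro r
        rw [Finset.add_sum_erase _ (fun j => if r j = v then (1 : ℤ) else 0) (Finset.mem_univ i)]
        simp
      have hu : ∑ j ∈ Finset.univ.erase i, (if Function.update s i u j = v then (1 : ℤ) else 0) =
          ∑ j ∈ Finset.univ.erase i, if s j = v then 1 else 0 :=
        Finset.sum_congr rfl fun j hj => by
          rw [Function.update_of_ne (Finset.ne_of_mem_erase hj)]
      rw [hc s, hc (Function.update s i u), Function.update_self, hu]
      simp only [eq_comm (a := v)]
      ring)
    have hs : ∀ j, ∃ w : G.Walk (s j) (t (σ j)), ∀ e ∈ w.edges,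
        e ∈ (W j).edges ∨ (j = i ∧ e = s(s i, u)) := by
      intro j
      by_cases hj : j = i
      · subst hj
        refine ⟨.cons hadj ((W j).copy (Function.update_self ..) rfl), fun e he => ?_⟩
        simp at he
        tauto
      · refine ⟨(W j).copy (Function.update_of_ne hj _ _) rfl, fun e he => ?_⟩
        simp at he
        tauto
    choose W' hW' using hs
    refine ⟨σ, W', fun a b => ?_⟩
    rw [← hle a b]
    calc (∑ j, if s(a, b) ∈ (W' j).edges then 1 else 0)
        ≤ ∑ j, ((if s(a, b) ∈ (W j).edges then 1 else 0) +
            if j = i then (if (a = s i ∧ b = u) ∨ (a = u ∧ b = s i) then 1 else 0) else 0) := by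
          refine Finset.sum_le_sum fun j _ => ?_
          have := hW' j s(a, b)
          rw [Sym2.eq_iff] at this
          split_ifs <;> first | omega | (exfalso; tauto)
      _ ≤ _ := by
          rw [Finset.sum_add_distrib]
          simp only [Finset.sum_ite_eq', Finset.mem_univ, if_true]
          exact Nat.add_le_add_right (hW a b) _

/-- A flow of unit demands decomposes into a matching of the sources with the sinks, routed along
paths with congestion at most the edge capacity. -/
theorem exists_matching [Fintype V] [DecidableEq V] {G : SimpleGraph V} {k : ℕ}
    {A B : Finset V} {f : V → V → ℤ} (hf : IsFlow G k f)
    (ho : ∀ v, out f v = (if v ∈ A then 1 else 0) - (if v ∈ B then 1 else 0)) :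
    ∃ (M : Finset (V × V)) (P : (p : V × V) → p ∈ M → G.Walk p.1 p.2),
      (∀ p ∈ M, p.1 ∈ A ∧ p.2 ∈ B) ∧
      (∀ p ∈ M, ∀ q ∈ M, p ≠ q → p.1 ≠ q.1 ∧ p.2 ≠ q.2) ∧
      M.card = A.card ∧
      (∀ p hp, (P p hp).IsPath) ∧
      ∀ a b, (M.attach.filter fun p => s(a, b) ∈ (P p.1 p.2).edges).card ≤ k := by
  have hcard : A.card = B.card := by
    have := sum_out hf.antisymm
    simp only [ho, Finset.sum_sub_distrib, Finset.sum_boole, Finset.filter_mem_eq_inter,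
      Finset.univ_inter] at this
    omega
  let e : A ≃ B := Finset.equivOfCardEq hcard
  obtain ⟨σ, W, hW⟩ := exists_walks (fun i : A => (e i : V)) _ (fun i : A => (i : V)) f hf rfl (by
    intro v
    have hc : ∀ C : Finset V, (Finset.univ.filter fun i : C => (i : V) = v).card =
        if v ∈ C then 1 else 0 := by
      intro C
      split_ifs with h
      · rw [Finset.card_eq_one]
        exact ⟨⟨v, h⟩, by ext i; simp [Subtype.ext_iff]⟩
      · rw [Finset.card_eq_zero, Finset.filter_eq_empty_iff]
        rintro i - rfl
        exact h i.2
    have hB : (Finset.univ.filter fun i : A => (e i : V) = v).card =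
        (Finset.univ.filter fun i : B => (i : V) = v).card :=
      Finset.card_equiv e (by simp)
    rw [ho, hB, hc, hc]
    push_cast
    rfl)
  let g : A → V × V := fun i => (i, e (σ i))
  have hg1 : ∀ i j, (g i).1 = (g j).1 → i = j := fun i j h => Subtype.ext h
  have hg2 : ∀ i j, (g i).2 = (g j).2 → i = j := fun i j h =>
    σ.injective (e.injective (Subtype.ext h))
  have hP : ∀ p ∈ Finset.univ.image g, ∃ i, g i = p ∧ ∃ w : G.Walk p.1 p.2, w.IsPath ∧
      ∀ x ∈ w.edges, x ∈ (W i).edges := by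
    intro p hp
    obtain ⟨i, -, rfl⟩ := Finset.mem_image.mp hp
    exact ⟨i, rfl, (W i).bypass, (W i).bypass_isPath, fun x hx => (W i).edges_bypass_subset_edges hx⟩
  choose I hI P hpath hedge using hP
  refine ⟨Finset.univ.image g, P, ?_, ?_, ?_, hpath, fun a b => ?_⟩
  · intro p hp
    obtain ⟨i, -, rfl⟩ := Finset.mem_image.mp hp
    exact ⟨i.2, (e (σ i)).2⟩
  · intro p hp q hq hpq
    obtain ⟨i, -, rfl⟩ := Finset.mem_image.mp hp
    obtain ⟨j, -, rfl⟩ := Finset.mem_image.mp hq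
    exact ⟨fun h => hpq (congrArg g (hg1 i j h)), fun h => hpq (congrArg g (hg2 i j h))⟩
  · rw [Finset.card_image_of_injective _ fun i j h => hg1 i j (congrArg Prod.fst h)]
    simp
  · calc _ ≤ (Finset.univ.filter fun i => s(a, b) ∈ (W i).edges).card := by
          refine Finset.card_le_card_of_injOn (fun p => I p.1 p.2) (fun p hp => ?_)
            fun p _ q _ hpq => Subtype.ext ?_
          · have hp := (Finset.mem_filter.mp hp).2
            exact Finset.mem_filter.mpr ⟨Finset.mem_univ _, hedge _ _ _ hp⟩
          · rw [← hI p.1 p.2, ← hI q.1 q.2]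
            exact congrArg g hpq
      _ = ∑ i, if s(a, b) ∈ (W i).edges then 1 else 0 := by rw [Finset.card_filter]
      _ ≤ (f a b).natAbs := hW a b
      _ ≤ k := by
          have h1 := hf.le_cap a b
          have h2 := hf.le_cap b a
          have h3 := hf.antisymm a b
          split_ifs at h1 h2 <;> omega

end MatchOrCut

/-- the combinatorial content of the `MatchOrCut` theorem.  Either
there is a matching of `A` into `B` of size greater than `N − z` whose pairs can
be connected by paths of congestion at most `c·(log₂ n)/ψ`, or there is a
balanced cut of sparsity at most `ψ`. -/
theorem match_or_cut :
    ∃ c : ℝ, 0 < c ∧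
      ∀ (V : Type) [Fintype V] [DecidableEq V] (G : SimpleGraph V)
        (A B : Finset V) (N z : ℕ) (ψ : ℝ),
        2 ≤ Fintype.card V → Disjoint A B → A.card ≤ B.card → A.card = N →
        1 ≤ z → 0 < ψ → ψ < 1 / 2 →
        (∃ (M : Finset (V × V)) (P : (p : V × V) → p ∈ M → G.Walk p.1 p.2),
            (∀ p ∈ M, p.1 ∈ A ∧ p.2 ∈ B) ∧
            (∀ p ∈ M, ∀ q ∈ M, p ≠ q → p.1 ≠ q.1 ∧ p.2 ≠ q.2) ∧
            (N : ℝ) - (z : ℝ) < (M.card : ℝ) ∧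
            (∀ p hp, (P p hp).IsPath) ∧
            (∀ a b, G.Adj a b →
              ((M.attach.filter fun p => s(a, b) ∈ (P p.1 p.2).edges).card : ℝ) ≤
                c * Real.logb 2 (Fintype.card V) / ψ)) ∨
          (∃ X Y : Finset V, Disjoint X Y ∧ X ∪ Y = Finset.univ ∧
            (z : ℝ) / 2 ≤ (X.card : ℝ) ∧ (z : ℝ) / 2 ≤ (Y.card : ℝ) ∧
            (interEdges G X Y : ℝ) ≤ ψ * ((min X.card Y.card : ℕ) : ℝ)) := by
  refine ⟨2, two_pos, ?_⟩
  intro V _ _ G A B N z ψ hn _ hle hN hz hψ hψ2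
  set k : ℕ := ⌈1 / ψ⌉₊ with hk
  have hk1 : 1 / ψ ≤ k := Nat.le_ceil _
  have hk2 : (k : ℝ) < 1 / ψ + 1 := Nat.ceil_lt_add_one (by positivity)
  rcases MatchOrCut.exists_flow_or_cut G k A B (N + 1 - z) with
    ⟨A', hA', B', hB', f, hf, hm, ho⟩ | ⟨S, hS⟩
  · left
    obtain ⟨M, P, h1, h2, h3, h4, h5⟩ := MatchOrCut.exists_matching hf ho
    refine ⟨M, P, fun p hp => ⟨hA' (h1 p hp).1, hB' (h1 p hp).2⟩, h2, ?_, h4, fun a b _ => ?_⟩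
    · have : N < M.card + z := by omega
      have : (N : ℝ) < M.card + z := by exact_mod_cast this
      linarith
    · have hlog : 1 ≤ Real.logb 2 (Fintype.card V) := by
        rw [Real.le_logb_iff_rpow_le one_lt_two (by positivity)]
        simpa using hn
      have hψ1 : 1 ≤ 1 / ψ := by
        rw [le_div_iff₀ hψ]
        linarith
      calc _ ≤ (k : ℝ) := by exact_mod_cast h5 a b
        _ ≤ 2 * (1 / ψ) := by linarith
        _ ≤ 2 * Real.logb 2 (Fintype.card V) * (1 / ψ) := by
            gcongr
            linarith
        _ = _ := by ring
  · right
    have hA := Finset.card_sdiff_add_card_inter A S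
    have hB := Finset.card_sdiff_add_card_inter B S
    have hAS : (A ∩ S).card ≤ S.card := Finset.card_le_card Finset.inter_subset_right
    have hBS : (B \ S).card ≤ Sᶜ.card := Finset.card_le_card fun v hv =>
      Finset.mem_compl.mpr (Finset.mem_sdiff.mp hv).2
    have hX : z ≤ S.card := by omega
    have hY : z ≤ Sᶜ.card := by omega
    have hX' : (z : ℝ) ≤ S.card := by exact_mod_cast hX
    have hY' : (z : ℝ) ≤ Sᶜ.card := by exact_mod_cast hY
    have hz0 : (0 : ℝ) ≤ z := by positivity
    refine ⟨S, Sᶜ, disjoint_compl_right, Finset.union_compl S, by linarith, by linarith, ?_⟩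
    have hE : k * interEdges G S Sᶜ ≤ min S.card Sᶜ.card := by omega
    have hE' : (k : ℝ) * interEdges G S Sᶜ ≤ (min S.card Sᶜ.card : ℕ) := by exact_mod_cast hE
    calc (interEdges G S Sᶜ : ℝ) = ψ * (1 / ψ * interEdges G S Sᶜ) := by field_simp
      _ ≤ ψ * (k * interEdges G S Sᶜ) := by gcongr
      _ ≤ _ := by gcongr
end

section
/- Let D and G be weighted graphs (possibly with self-loops) on the same finite vertex set V with |V| ≥ 2, given by symmetric weight functions w_D, w_G : V × V → ℝ_{≥0}. Suppose that every vertex has the same weighted degree in D as in G and that all weighted degrees are positive, and suppose both D and G have weighted conductance at least φ for some φ ∈ (0,1]. Then for every vector x ∈ ℝ^V: (φ²/4)·xᵀL_G x ≤ xᵀL_D x ≤ (4/φ²)·xᵀL_G x. -/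
open Finset
open scoped Classical

variable {V : Type*}

/-- The weighted degree of a vertex. -/
noncomputable def wdeg [Fintype V] (w : V → V → ℝ) (v : V) : ℝ :=
  ∑ u : V, w v u

/-- The weighted volume of a vertex set. -/
noncomputable def wvol [Fintype V] (w : V → V → ℝ) (S : Finset V) : ℝ :=
  ∑ v ∈ S, wdeg w v

/-- The total weight of edges crossing the cut `S`. -/
noncomputable def wcut [Fintype V] [DecidableEq V] (w : V → V → ℝ) (S : Finset V) : ℝ :=
  ∑ v ∈ S, ∑ u ∈ Sᶜ, w v u

/-- The weighted graph `w` has conductance at least `φ`. -/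
def wcondGe [Fintype V] [DecidableEq V] (w : V → V → ℝ) (φ : ℝ) : Prop :=
  ∀ S : Finset V, S.Nonempty → Sᶜ.Nonempty →
    φ * min (wvol w S) (wvol w Sᶜ) ≤ wcut w S

/-- The Laplacian quadratic form
`xᵀLx = (1/2)·Σ_{u,v} w(u,v)·(x_u − x_v)²` (diagonal terms vanish, so
self-loops do not contribute). -/
noncomputable def lapForm [Fintype V] (w : V → V → ℝ) (x : V → ℝ) : ℝ :=
  (1 / 2) * ∑ u : V, ∑ v : V, w u v * (x u - x v) ^ 2

/-- Summing `f u + f v` over the edges of a symmetric weighted graph counts each vertex with twice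
its degree. -/
lemma sum_weight_mul_add [Fintype V] {w : V → V → ℝ} (hsymm : ∀ u v, w u v = w v u) (f : V → ℝ) :
    ∑ u, ∑ v, w u v * (f u + f v) = 2 * ∑ v, wdeg w v * f v := by
  have h : ∑ u, ∑ v, w u v * f v = ∑ v, wdeg w v * f v := by
    rw [Finset.sum_comm]
    refine Finset.sum_congr rfl fun v _ => ?_
    rw [wdeg, Finset.sum_mul]
    exact Finset.sum_congr rfl fun u _ => by rw [hsymm]
  have h' : ∑ u, ∑ v, w u v * f u = ∑ v, wdeg w v * f v :=
    Finset.sum_congr rfl fun u _ => by rw [wdeg, Finset.sum_mul]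
  simp only [mul_add, Finset.sum_add_distrib, h, h']
  ring

/-- The total variation of the indicator function of a set is twice its cut. -/
lemma sum_weight_mul_abs_indicator [Fintype V] [DecidableEq V] {w : V → V → ℝ}
    (hsymm : ∀ u v, w u v = w v u) (S : Finset V) :
    ∑ u, ∑ v, w u v * |(if u ∈ S then (1 : ℝ) else 0) - (if v ∈ S then (1 : ℝ) else 0)| =
      2 * wcut w S := by
  have h : wcut w S = ∑ u, ∑ v, if u ∈ S ∧ v ∉ S then w u v else 0 := by
    rw [wcut, ← Finset.sum_filter_add_sum_filter_not Finset.univ (· ∈ S)]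
    rw [Finset.sum_eq_zero (s := Finset.univ.filter (· ∉ S)), add_zero]
    · refine Finset.sum_congr (by ext; simp) fun u hu => ?_
      simp only [Finset.mem_filter, Finset.mem_univ, true_and] at hu
      simp only [hu, true_and, ← Finset.sum_filter]
      exact Finset.sum_congr (by ext; simp) fun _ _ => rfl
    · intro u hu
      simp only [Finset.mem_filter, Finset.mem_univ, true_and] at hu
      simp [hu]
  have h' : wcut w S = ∑ u, ∑ v, if v ∈ S ∧ u ∉ S then w u v else 0 := by
    rw [h, Finset.sum_comm]
    simp only [hsymm]
  rw [two_mul]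
  nth_rewrite 1 [h]
  rw [h', ← Finset.sum_add_distrib]
  refine Finset.sum_congr rfl fun u _ => ?_
  rw [← Finset.sum_add_distrib]
  refine Finset.sum_congr rfl fun v _ => ?_
  by_cases hu : u ∈ S <;> by_cases hv : v ∈ S <;> simp [hu, hv]

/-- The layer-cake form of an isoperimetric inequality: if all subsets of the support of a
nonnegative function expand, then its total variation is bounded below by its weighted sum. -/
lemma two_mul_sum_le_totalVariation [Fintype V] [DecidableEq V] {w : V → V → ℝ} {φ : ℝ}
    (hsymm : ∀ u v, w u v = w v u) (S : Finset V)
    (hS : ∀ T ⊆ S, φ * wvol w T ≤ wcut w T) (g : V → ℝ) (hg : ∀ v, 0 ≤ g v)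
    (hgS : ∀ v, v ∉ S → g v = 0) :
    2 * φ * ∑ v, wdeg w v * g v ≤ ∑ u, ∑ v, w u v * |g u - g v| := by
  induction S using Finset.strongInduction generalizing g with
  | H S ih =>
    rcases S.eq_empty_or_nonempty with rfl | hne
    · have h0 : ∀ v, g v = 0 := fun v => hgS v (by simp)
      simp [h0]
    obtain ⟨a, haS, ha⟩ := Finset.exists_min_image S g hne
    set i : V → ℝ := fun v => if v ∈ S then 1 else 0 with hi
    set g' : V → ℝ := fun v => g v - g a * i v with hg'
    have key := ih (S.erase a) (Finset.erase_ssubset haS)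
      (fun T hT => hS T (hT.trans (Finset.erase_subset a S))) g'
      (fun v => by
        by_cases hv : v ∈ S
        · simpa [hg', hi, hv] using ha v hv
        · simp [hg', hi, hv, hgS v hv])
      (fun v hv => by
        by_cases hva : v = a
        · simp [hg', hi, hva, haS]
        · have hvS : v ∉ S := fun h => hv (Finset.mem_erase.2 ⟨hva, h⟩)
          simp [hg', hi, hvS, hgS v hvS])
    have hsplit : ∀ u v, |g u - g v| = |g' u - g' v| + g a * |i u - i v| := by
      intro u v
      by_cases hu : u ∈ S <;> by_cases hv : v ∈ S
      · simp [hg', hi, hu, hv]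
      · have := ha u hu
        simp [hg', hi, hu, hv, hgS v hv, abs_of_nonneg (hg u), abs_of_nonneg (sub_nonneg.2 this)]
      · have := ha v hv
        simp [hg', hi, hu, hv, hgS u hu, abs_of_nonneg (hg v),
          abs_of_nonpos (sub_nonpos.2 this)]
      · simp [hg', hi, hu, hv]
    have hvol : ∑ v, wdeg w v * g v = ∑ v, wdeg w v * g' v + g a * wvol w S := by
      have : wvol w S = ∑ v, wdeg w v * i v := by simp [wvol, hi]
      rw [this, Finset.mul_sum, ← Finset.sum_add_distrib]
      exact Finset.sum_congr rfl fun v _ => by simp only [hg']; ring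
    have hTV : ∑ u, ∑ v, w u v * |g u - g v| =
        ∑ u, ∑ v, w u v * |g' u - g' v| + g a * (2 * wcut w S) := by
      rw [← sum_weight_mul_abs_indicator hsymm S]
      simp only [Finset.mul_sum, ← Finset.sum_add_distrib]
      exact Finset.sum_congr rfl fun u _ => Finset.sum_congr rfl fun v _ => by
        rw [hsplit]; ring
    rw [hvol, hTV]
    linarith [mul_le_mul_of_nonneg_left (hS S subset_rfl) (hg a)]

lemma wvol_mono [Fintype V] {w : V → V → ℝ} (hd : ∀ v, 0 ≤ wdeg w v) {S T : Finset V}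
    (h : S ⊆ T) : wvol w S ≤ wvol w T :=
  Finset.sum_le_sum_of_subset_of_nonneg h fun v _ _ => hd v

/-- A set of at most half of the total volume expands, in a graph of large conductance. -/
lemma wcondGe.mul_wvol_le_wcut [Fintype V] [DecidableEq V] {w : V → V → ℝ} {φ : ℝ}
    (h : wcondGe w φ) (hpos : ∀ v, 0 < wdeg w v) {S : Finset V} (hS : wvol w S ≤ wvol w Sᶜ) :
    φ * wvol w S ≤ wcut w S := by
  rcases S.eq_empty_or_nonempty with rfl | hne
  · simp [wvol, wcut]
  have hS0 : 0 < wvol w S := Finset.sum_pos (fun v _ => hpos v) hne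
  have hc : Sᶜ.Nonempty := by
    by_contra hc
    rw [Finset.not_nonempty_iff_eq_empty] at hc
    rw [hc] at hS
    simp only [wvol, Finset.sum_empty] at hS hS0
    linarith
  simpa [min_eq_left hS] using h S hne hc

/-- Every function has a weighted median. -/
lemma exists_weighted_median [Fintype V] [DecidableEq V] [Nonempty V] {w : V → V → ℝ}
    (hd : ∀ v, 0 ≤ wdeg w v) (x : V → ℝ) :
    ∃ c : ℝ, wvol w {v | c < x v} ≤ wvol w ({v | c < x v} : Finset V)ᶜ ∧
      wvol w {v | x v < c} ≤ wvol w ({v | x v < c} : Finset V)ᶜ := by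
  have hnonneg : ∀ S : Finset V, 0 ≤ wvol w S := fun S => Finset.sum_nonneg fun v _ => hd v
  obtain ⟨m, -, hm⟩ := Finset.exists_max_image Finset.univ x Finset.univ_nonempty
  have hmem : m ∈ ({u | wvol w {v | x u < x v} ≤ wvol w ({v | x u < x v} : Finset V)ᶜ} :
      Finset V) := by
    have : ({v | x m < x v} : Finset V) = ∅ := by
      ext v
      simpa using hm v (Finset.mem_univ v)
    simp only [Finset.mem_filter, Finset.mem_univ, true_and, this]
    exact wvol_mono hd (Finset.empty_subset _)
  obtain ⟨a, ha, hmin⟩ := Finset.exists_min_image _ x ⟨m, hmem⟩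
  simp only [Finset.mem_filter, Finset.mem_univ, true_and] at ha hmin
  refine ⟨x a, ha, ?_⟩
  rcases ({v | x v < x a} : Finset V).eq_empty_or_nonempty with he | hne
  · rw [he]
    exact wvol_mono hd (Finset.empty_subset _)
  obtain ⟨b, hb, hmax⟩ := Finset.exists_max_image _ x hne
  simp only [Finset.mem_filter, Finset.mem_univ, true_and] at hb hmax
  have hset : ({v | x b < x v} : Finset V) = ({v | x v < x a} : Finset V)ᶜ := by
    ext v
    simp only [Finset.mem_filter, Finset.mem_univ, true_and, Finset.mem_compl, not_lt]
    refine ⟨fun h => ?_, hb.trans_le⟩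
    by_contra! hv
    exact (hmax v hv).not_gt h
  have hnot := mt (hmin b) (not_le.2 hb)
  rw [hset, compl_compl, not_le] at hnot
  exact hnot.le

/-- Cheeger's inequality in `L¹` form, for functions with weighted median `0`. -/
lemma wcondGe.two_mul_sum_abs_le_totalVariation [Fintype V] [DecidableEq V] {w : V → V → ℝ}
    {φ : ℝ} (h : wcondGe w φ) (hsymm : ∀ u v, w u v = w v u) (hpos : ∀ v, 0 < wdeg w v)
    (f : V → ℝ) (h₁ : wvol w {v | 0 < f v} ≤ wvol w ({v | 0 < f v} : Finset V)ᶜ)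
    (h₂ : wvol w {v | f v < 0} ≤ wvol w ({v | f v < 0} : Finset V)ᶜ) :
    2 * φ * ∑ v, wdeg w v * |f v| ≤ ∑ u, ∑ v, w u v * |f u - f v| := by
  have hsub : ∀ S : Finset V, wvol w S ≤ wvol w Sᶜ → ∀ T ⊆ S, φ * wvol w T ≤ wcut w T :=
    fun S hS T hT => h.mul_wvol_le_wcut hpos <|
      ((wvol_mono (fun v => (hpos v).le) hT).trans hS).trans
        (wvol_mono (fun v => (hpos v).le) (Finset.compl_subset_compl.2 hT))
  have hp := two_mul_sum_le_totalVariation hsymm _ (hsub _ h₁) (fun v => max (f v) 0)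
    (fun v => le_max_right _ _) (fun v hv => by simpa using hv)
  have hn := two_mul_sum_le_totalVariation hsymm _ (hsub _ h₂) (fun v => max (-f v) 0)
    (fun v => le_max_right _ _) (fun v hv => by simpa using hv)
  have habs : ∀ t : ℝ, |t| = max t 0 + max (-t) 0 := fun t => by
    rcases le_total 0 t with ht | ht <;> simp [ht, abs_of_nonneg, abs_of_nonpos]
  have hdiff : ∀ s t : ℝ, |s - t| = |max s 0 - max t 0| + |max (-s) 0 - max (-t) 0| := by
    intro s t
    grind
  simp only [habs (f _), hdiff (f _), mul_add, Finset.sum_add_distrib] at hp hn ⊢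
  linarith

lemma abs_mul_abs_sub_mul_abs_le (s t : ℝ) :
    |s * |s| - t * (|t|)| ≤ |s - t| * (|s| + |t|) := by
  rcases le_total 0 s with hs | hs <;> rcases le_total 0 t with ht | ht <;>
    simp only [abs_of_nonneg, abs_of_nonpos, hs, ht]
  · rw [← abs_of_nonneg (add_nonneg hs ht), ← abs_mul]
    exact (congrArg _ (by ring)).le
  · rw [abs_of_nonneg (by linarith : 0 ≤ s - t)]
    exact abs_le.2 ⟨by nlinarith, by nlinarith [mul_nonneg hs (neg_nonneg.2 ht)]⟩
  · rw [abs_of_nonpos (by linarith : s - t ≤ 0)]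
    exact abs_le.2 ⟨by nlinarith [mul_nonneg ht (neg_nonneg.2 hs)], by nlinarith⟩
  · rw [← abs_of_nonneg (by linarith : 0 ≤ -s + -t), ← abs_mul]
    exact (congrArg _ (by ring)).le

/-- The Laplacian form is at most twice the degree form, about any center. -/
lemma lapForm_le_two_mul_sum [Fintype V] {w : V → V → ℝ} (hsymm : ∀ u v, w u v = w v u)
    (hnn : ∀ u v, 0 ≤ w u v) (x : V → ℝ) (c : ℝ) :
    lapForm w x ≤ 2 * ∑ v, wdeg w v * (x v - c) ^ 2 := by
  rw [← sum_weight_mul_add hsymm, lapForm, Finset.mul_sum]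
  refine Finset.sum_le_sum fun u _ => ?_
  rw [Finset.mul_sum]
  refine Finset.sum_le_sum fun v _ => ?_
  nlinarith [mul_nonneg (hnn u v) (sq_nonneg (x u - c + (x v - c)))]

/-- Cheeger's inequality, with the mean replaced by a suitable center. -/
lemma wcondGe.exists_sq_mul_sum_le_lapForm [Fintype V] [DecidableEq V] [Nonempty V]
    {w : V → V → ℝ} {φ : ℝ} (h : wcondGe w φ) (hφ : 0 ≤ φ) (hsymm : ∀ u v, w u v = w v u)
    (hnn : ∀ u v, 0 ≤ w u v) (hpos : ∀ v, 0 < wdeg w v) (x : V → ℝ) :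
    ∃ c : ℝ, φ ^ 2 * ∑ v, wdeg w v * (x v - c) ^ 2 ≤ 2 * lapForm w x := by
  obtain ⟨c, h₁, h₂⟩ := exists_weighted_median (fun v => (hpos v).le) x
  refine ⟨c, ?_⟩
  set y : V → ℝ := fun v => x v - c with hy
  set A := ∑ v, wdeg w v * y v ^ 2 with hA
  have hA0 : 0 ≤ A := Finset.sum_nonneg fun v _ => mul_nonneg (hpos v).le (sq_nonneg _)
  have hL0 : 0 ≤ lapForm w x := mul_nonneg (by norm_num) <|
    Finset.sum_nonneg fun u _ => Finset.sum_nonneg fun v _ => mul_nonneg (hnn u v) (sq_nonneg _)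
  have hpos_iff : ∀ v, 0 < y v * |y v| ↔ c < x v := fun v => by
    rw [← sub_pos (b := c)]
    change _ ↔ 0 < y v
    refine ⟨fun hv => ?_, fun hv => mul_pos hv (abs_pos.2 hv.ne')⟩
    by_contra! hle
    exact hv.not_ge (mul_nonpos_of_nonpos_of_nonneg hle (abs_nonneg _))
  have hneg_iff : ∀ v, y v * |y v| < 0 ↔ x v < c := fun v => by
    rw [← sub_neg (b := c)]
    change _ ↔ y v < 0
    refine ⟨fun hv => ?_, fun hv => mul_neg_of_neg_of_pos hv (abs_pos.2 hv.ne)⟩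
    by_contra! hle
    exact hv.not_ge (mul_nonneg hle (abs_nonneg _))
  have hTV := h.two_mul_sum_abs_le_totalVariation hsymm hpos (fun v => y v * |y v|)
    (by simpa only [hpos_iff] using h₁) (by simpa only [hneg_iff] using h₂)
  have hsq : ∀ v, |y v * (|y v|)| = y v ^ 2 := fun v => by
    rw [abs_mul, abs_abs, ← sq, sq_abs]
  simp only [hsq] at hTV
  set B := ∑ u, ∑ v, w u v * (|y u - y v| * (|y u| + |y v|)) with hB
  have hTVB : 2 * φ * A ≤ B := hTV.trans <|
    Finset.sum_le_sum fun u _ => Finset.sum_le_sum fun v _ =>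
      mul_le_mul_of_nonneg_left (abs_mul_abs_sub_mul_abs_le _ _) (hnn u v)
  have hCS : B ^ 2 ≤ (2 * lapForm w x) * (4 * A) := by
    have h2L : 2 * lapForm w x = ∑ p : V × V, w p.1 p.2 * (y p.1 - y p.2) ^ 2 := by
      rw [lapForm, Fintype.sum_prod_type]
      simp [hy]
    have h4A : ∑ p : V × V, w p.1 p.2 * (|y p.1| + |y p.2|) ^ 2 ≤ 4 * A := by
      have h4 : 4 * A = 2 * ∑ u, ∑ v, w u v * (y u ^ 2 + y v ^ 2) := by
        rw [sum_weight_mul_add hsymm (fun v => y v ^ 2)]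
        ring
      rw [h4, Fintype.sum_prod_type, Finset.mul_sum]
      refine Finset.sum_le_sum fun u _ => ?_
      rw [Finset.mul_sum]
      refine Finset.sum_le_sum fun v _ => ?_
      rw [← sq_abs (y u), ← sq_abs (y v)]
      nlinarith [mul_nonneg (hnn u v) (sq_nonneg (|y u| - |y v|))]
    have hB' : B = ∑ p : V × V, w p.1 p.2 * (|y p.1 - y p.2| * (|y p.1| + |y p.2|)) := by
      rw [hB, Fintype.sum_prod_type]
    refine le_trans ?_ (mul_le_mul_of_nonneg_left h4A (by positivity))
    rw [h2L, hB']
    refine Finset.sum_sq_le_sum_mul_sum_of_sq_le_mul _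
      (fun p _ => mul_nonneg (hnn _ _) (sq_nonneg _))
      (fun p _ => mul_nonneg (hnn _ _) (sq_nonneg _)) fun p _ => ?_
    rw [← sq_abs (y p.1 - y p.2)]
    exact (by ring : _ = _).le
  rcases hA0.eq_or_lt with hA' | hA'
  · rw [← hA']
    simpa using hL0
  · have hsqle : (2 * φ * A) ^ 2 ≤ B ^ 2 := by gcongr
    refine le_of_mul_le_mul_right ?_ hA'
    nlinarith

/-- The Laplacian of a graph is bounded by that of a graph with the same degrees and large
conductance. -/
lemma wcondGe.sq_mul_lapForm_le [Fintype V] [DecidableEq V] [Nonempty V]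
    {w w' : V → V → ℝ} {φ : ℝ} (h : wcondGe w φ) (hφ : 0 ≤ φ)
    (hsymm : ∀ u v, w u v = w v u) (hsymm' : ∀ u v, w' u v = w' v u)
    (hnn : ∀ u v, 0 ≤ w u v) (hnn' : ∀ u v, 0 ≤ w' u v)
    (hpos : ∀ v, 0 < wdeg w v) (hdeg : ∀ v, wdeg w' v = wdeg w v) (x : V → ℝ) :
    φ ^ 2 * lapForm w' x ≤ 4 * lapForm w x := by
  obtain ⟨c, hc⟩ := h.exists_sq_mul_sum_le_lapForm hφ hsymm hnn hpos x
  have hle := lapForm_le_two_mul_sum hsymm' hnn' x c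
  simp only [hdeg] at hle
  linarith [mul_le_mul_of_nonneg_left hle (sq_nonneg φ)]

/-- two weighted graphs with the same (positive) degrees, each of
conductance at least `φ`, have spectrally comparable Laplacians, up to the
factor `4/φ²`. -/
theorem degree_equal_conductance_spectral
    [Fintype V] [DecidableEq V]
    (wD wG : V → V → ℝ) (φ : ℝ)
    (hn : 2 ≤ Fintype.card V)
    (hDsymm : ∀ u v, wD u v = wD v u) (hGsymm : ∀ u v, wG u v = wG v u)
    (hDnn : ∀ u v, 0 ≤ wD u v) (hGnn : ∀ u v, 0 ≤ wG u v)
    (hdeg : ∀ v, wdeg wD v = wdeg wG v)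
    (hpos : ∀ v, 0 < wdeg wG v)
    (hφ0 : 0 < φ) (hφ1 : φ ≤ 1)
    (hDcond : wcondGe wD φ) (hGcond : wcondGe wG φ) :
    ∀ x : V → ℝ,
      φ ^ 2 / 4 * lapForm wG x ≤ lapForm wD x ∧
        lapForm wD x ≤ 4 / φ ^ 2 * lapForm wG x := by
  intro x
  have : Nonempty V := Fintype.card_pos_iff.1 (by omega)
  have h₁ := hDcond.sq_mul_lapForm_le hφ0.le hDsymm hGsymm hDnn hGnn
    (fun v => (hdeg v).symm ▸ hpos v) (fun v => (hdeg v).symm) x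
  have h₂ := hGcond.sq_mul_lapForm_le hφ0.le hGsymm hDsymm hGnn hDnn hpos hdeg x
  refine ⟨by linarith, ?_⟩
  rw [div_mul_eq_mul_div, le_div_iff₀ (by positivity)]
  linarith
end

section
/- Let V be a finite set with |V| ≥ 2 and let d : V → ℝ_{>0}. Consider the product demand graph H(d), the complete weighted graph with self-loops on V with weights w(u,v) = d_u·d_v for all u,v ∈ V. Then every cut ∅ ≠ S ⊊ V has weighted conductance at least 1/2; that is, Σ_{u∈S, v∉S} d_u·d_v ≥ (1/2)·min(Vol(S), Vol(V∖S)), where Vol(S) = Σ_{v∈S} Σ_{u∈V} d_v·d_u. -/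
open Finset
open scoped Classical

/-- every cut of the product demand graph `H(d)` (complete
weighted graph with self-loops, weight `d_u·d_v` on each pair) has weighted
conductance at least `1/2`. -/
theorem product_demand_graph_conductance
    {V : Type*} [Fintype V] [DecidableEq V]
    (d : V → ℝ) (hd : ∀ v, 0 < d v)
    (hn : 2 ≤ Fintype.card V)
    (S : Finset V) (hS : S.Nonempty) (hSc : Sᶜ.Nonempty) :
    (1 / 2) * min (∑ v ∈ S, ∑ u : V, d v * d u) (∑ v ∈ Sᶜ, ∑ u : V, d v * d u) ≤
      ∑ u ∈ S, ∑ v ∈ Sᶜ, d u * d v := by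
  have hA : 0 ≤ ∑ v ∈ S, d v := sum_nonneg fun v _ => (hd v).le
  have hB : 0 ≤ ∑ v ∈ Sᶜ, d v := sum_nonneg fun v _ => (hd v).le
  simp only [← sum_mul_sum]
  rw [← sum_add_sum_compl S d]
  generalize ∑ v ∈ S, d v = a at *
  generalize ∑ v ∈ Sᶜ, d v = b at *
  rcases le_total a b with h | h
  · nlinarith [min_le_left (a * (a + b)) (b * (a + b)), mul_le_mul_of_nonneg_left h hA]
  · nlinarith [min_le_right (a * (a + b)) (b * (a + b)), mul_le_mul_of_nonneg_left h hB]
end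

section
/- There is a universal constant c ≥ 1 such that the following holds. Let G be a weighted graph on a finite vertex set V with |V| = n ≥ 2, having m ≥ 2 edges with integer edge weights in {1,…,U} for some integer U ≥ 2, and let r ≥ 1 be an integer. Then there exists a weighted graph H on V with nonnegative edge weights and at most c·n·(log₂ n)·(log₂ U) edges such that, with α = (log₂ m)^{c·r²}, for every vector x ∈ ℝ^V: (1/α)·xᵀL_G x ≤ xᵀL_H x ≤ α·xᵀL_G x. -/
open Finset
open scoped Classical

variable {V : Type*}

section RankOneBarrier

open Matrix
open scoped MatrixOrder Matrix.Norms.L2Operator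

variable {ι : Type*} [Fintype ι]

lemma dotProduct_mulVec_symm {M : Matrix ι ι ℝ} (hM : M.IsHermitian) (x y : ι → ℝ) :
    x ⬝ᵥ (M *ᵥ y) = y ⬝ᵥ (M *ᵥ x) := by
  have h : Mᵀ = M := by simpa [Matrix.IsHermitian, conjTranspose_eq_transpose_of_trivial] using hM
  rw [dotProduct_mulVec, ← mulVec_transpose, h, dotProduct_comm]

/-- Cauchy–Schwarz for the pair of dual norms given by `M` and `M⁻¹`. -/
lemma Matrix.PosDef.dotProduct_sq_le {M : Matrix ι ι ℝ} [DecidableEq ι] (hM : M.PosDef)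
    (v x : ι → ℝ) : (v ⬝ᵥ x) ^ 2 ≤ (v ⬝ᵥ (M⁻¹ *ᵥ v)) * (x ⬝ᵥ (M *ᵥ x)) := by
  have hMi : M *ᵥ (M⁻¹ *ᵥ v) = v := by
    rw [mulVec_mulVec, mul_nonsing_inv _ ((isUnit_iff_isUnit_det _).1 hM.isUnit), one_mulVec]
  have key : ∀ c : ℝ, 0 ≤ (v ⬝ᵥ (M⁻¹ *ᵥ v)) * (c * c) + (-2 * (v ⬝ᵥ x)) * c
      + x ⬝ᵥ (M *ᵥ x) := by
    intro c
    have h := hM.posSemidef.dotProduct_mulVec_nonneg (x - c • (M⁻¹ *ᵥ v))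
    rw [star_trivial] at h
    have h2 := dotProduct_mulVec_symm hM.isHermitian (M⁻¹ *ᵥ v) x
    rw [hMi] at h2
    simp only [mulVec_sub, mulVec_smul, hMi, sub_dotProduct, dotProduct_sub, smul_dotProduct,
      dotProduct_smul, smul_eq_mul] at h
    rw [h2, dotProduct_comm x v, dotProduct_comm (M⁻¹ *ᵥ v) v] at h
    linarith
  have := discrim_le_zero key
  rw [discrim] at this
  linarith

/-- Sherman–Morrison: positivity and trace of the inverse under a symmetric rank-one update. -/
lemma Matrix.PosDef.add_smul_vecMulVec {M : Matrix ι ι ℝ} [DecidableEq ι] (hM : M.PosDef)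
    (v : ι → ℝ) {τ : ℝ} (hτ : 0 < 1 + τ * (v ⬝ᵥ (M⁻¹ *ᵥ v))) :
    (M + τ • vecMulVec v v).PosDef ∧
      ((M + τ • vecMulVec v v)⁻¹).trace =
        (M⁻¹).trace - τ * (v ⬝ᵥ ((M⁻¹ * M⁻¹) *ᵥ v)) / (1 + τ * (v ⬝ᵥ (M⁻¹ *ᵥ v))) := by
  have hdet := (isUnit_iff_isUnit_det _).1 hM.isUnit
  have hMi : M * M⁻¹ = 1 := mul_nonsing_inv _ hdet
  have hiT : (M⁻¹)ᵀ = M⁻¹ := by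
    simpa [Matrix.IsHermitian, conjTranspose_eq_transpose_of_trivial] using hM.inv.isHermitian
  set q := v ⬝ᵥ (M⁻¹ *ᵥ v) with hq
  constructor
  · refine .of_dotProduct_mulVec_pos (hM.isHermitian.add ?_) fun x hx => ?_
    · simp [Matrix.IsHermitian]
    · have hx' := hM.dotProduct_mulVec_pos hx
      have hcs := hM.dotProduct_sq_le v x
      rw [star_trivial] at hx' ⊢
      have : x ⬝ᵥ ((M + τ • vecMulVec v v) *ᵥ x) = x ⬝ᵥ (M *ᵥ x) + τ * (v ⬝ᵥ x) ^ 2 := by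
        simp only [add_mulVec, smul_mulVec, vecMulVec_mulVec, dotProduct_add, dotProduct_smul]
        simp only [op_smul_eq_smul, smul_eq_mul, dotProduct_comm x v]
        ring
      rw [this]
      rcases le_total 0 τ with h | h
      · positivity
      · nlinarith
  · have hv : v ᵥ* M⁻¹ = M⁻¹ *ᵥ v := by rw [← mulVec_transpose, hiT]
    have hinv : (M + τ • vecMulVec v v)⁻¹ =
        M⁻¹ - (τ / (1 + τ * q)) • vecMulVec (M⁻¹ *ᵥ v) (M⁻¹ *ᵥ v) := by
      apply inv_eq_right_inv
      have h1 : M * vecMulVec (M⁻¹ *ᵥ v) (M⁻¹ *ᵥ v) = vecMulVec v (M⁻¹ *ᵥ v) := by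
        rw [mul_vecMulVec, mulVec_mulVec, hMi, one_mulVec]
      have h2 : vecMulVec v v * M⁻¹ = vecMulVec v (M⁻¹ *ᵥ v) := by
        rw [vecMulVec_mul, hv]
      have h3 : vecMulVec v v * vecMulVec (M⁻¹ *ᵥ v) (M⁻¹ *ᵥ v) =
          q • vecMulVec v (M⁻¹ *ᵥ v) := by
        rw [vecMulVec_mul_vecMulVec, ← hq, vecMulVec_smul]
      rw [add_mul, mul_sub, mul_sub, hMi, smul_mul_assoc, smul_mul_assoc, mul_smul_comm,
        mul_smul_comm, h1, h2, h3, smul_smul, smul_smul, sub_add, sub_eq_self, ← sub_smul,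
        ← sub_smul, smul_eq_zero]
      left
      field_simp
      ring
    rw [hinv, trace_sub, trace_smul, trace_vecMulVec, ← mulVec_mulVec, dotProduct_mulVec v, hv,
      smul_eq_mul]
    ring

variable [DecidableEq ι]

omit [Fintype ι] in
lemma Matrix.PosDef.add_smul_one {M : Matrix ι ι ℝ} (hM : M.PosDef) {δ : ℝ} (hδ : 0 ≤ δ) :
    (M + δ • (1 : Matrix ι ι ℝ)).PosDef :=
  hM.add_posSemidef (PosSemidef.one.smul hδ)

lemma inv_sub_inv_add_smul_one {M : Matrix ι ι ℝ} (hM : M.PosDef) {δ : ℝ} (hδ : 0 ≤ δ) :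
    M⁻¹ - (M + δ • (1 : Matrix ι ι ℝ))⁻¹ = δ • (M⁻¹ * (M + δ • (1 : Matrix ι ι ℝ))⁻¹) ∧
    M⁻¹ - (M + δ • (1 : Matrix ι ι ℝ))⁻¹ = δ • ((M + δ • (1 : Matrix ι ι ℝ))⁻¹ * M⁻¹) := by
  have h := (isUnit_iff_isUnit_det _).1 hM.isUnit
  have h' := (isUnit_iff_isUnit_det _).1 (hM.add_smul_one hδ).isUnit
  have e : M⁻¹ * ((M + δ • (1 : Matrix ι ι ℝ)) - M) * (M + δ • (1 : Matrix ι ι ℝ))⁻¹ =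
      M⁻¹ - (M + δ • (1 : Matrix ι ι ℝ))⁻¹ := by
    rw [mul_sub, sub_mul, mul_nonsing_inv_cancel_right _ _ h', nonsing_inv_mul _ h, one_mul]
  have e' : (M + δ • (1 : Matrix ι ι ℝ))⁻¹ * ((M + δ • (1 : Matrix ι ι ℝ)) - M) * M⁻¹ =
      M⁻¹ - (M + δ • (1 : Matrix ι ι ℝ))⁻¹ := by
    rw [mul_sub, sub_mul, mul_nonsing_inv_cancel_right _ _ h, nonsing_inv_mul _ h', one_mul]
  rw [add_sub_cancel_left] at e e'
  constructor
  · rw [← e]; simp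
  · rw [← e']; simp

lemma trace_conj_inv_nonneg {M N : Matrix ι ι ℝ} (hM : M.PosDef) (hN : N.PosDef) :
    0 ≤ (N⁻¹ * M⁻¹ * N⁻¹).trace := by
  have h := (hM.inv.posSemidef.conjTranspose_mul_mul_same N⁻¹).trace_nonneg
  rwa [hN.inv.isHermitian] at h

lemma le_trace_inv_sub_trace_inv {M : Matrix ι ι ℝ} (hM : M.PosDef) {δ : ℝ} (hδ : 0 ≤ δ) :
    δ * ((M + δ • (1 : Matrix ι ι ℝ))⁻¹ * (M + δ • (1 : Matrix ι ι ℝ))⁻¹).trace ≤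
      (M⁻¹).trace - ((M + δ • (1 : Matrix ι ι ℝ))⁻¹).trace := by
  obtain ⟨e, e'⟩ := inv_sub_inv_add_smul_one hM hδ
  have h := trace_conj_inv_nonneg hM (hM.add_smul_one hδ)
  have h1 := congrArg (fun X => ((M + δ • (1 : Matrix ι ι ℝ))⁻¹ * X).trace) e
  have h2 := congrArg Matrix.trace e'
  simp only [mul_sub, mul_smul_comm, trace_smul, trace_sub, smul_eq_mul, ← mul_assoc] at h1 h2
  rw [h2]
  have h3 := mul_nonneg hδ h
  gcongr
  linarith

lemma trace_inv_sub_trace_inv_le {M : Matrix ι ι ℝ} (hM : M.PosDef) {δ : ℝ} (hδ : 0 ≤ δ) :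
    (M⁻¹).trace - ((M + δ • (1 : Matrix ι ι ℝ))⁻¹).trace ≤ δ * (M⁻¹ * M⁻¹).trace := by
  obtain ⟨e, e'⟩ := inv_sub_inv_add_smul_one hM hδ
  have h := trace_conj_inv_nonneg (hM.add_smul_one hδ) hM
  have h1 := congrArg (fun X => (M⁻¹ * X).trace) e'
  have h2 := congrArg Matrix.trace e
  simp only [mul_sub, mul_smul_comm, trace_smul, trace_sub, smul_eq_mul, ← mul_assoc] at h1 h2
  rw [h2]
  have h3 := mul_nonneg hδ h
  gcongr
  linarith

lemma Matrix.PosDef.mul_self_inv {M : Matrix ι ι ℝ} (hM : M.PosDef) : (M⁻¹ * M⁻¹).PosDef := by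
  have h := PosDef.one.conjTranspose_mul_mul_same (B := M⁻¹)
    (mulVec_injective_iff_isUnit.2 hM.inv.isUnit)
  rwa [mul_one, hM.inv.isHermitian] at h

lemma Matrix.PosSemidef.dotProduct_mulVec_le_trace {N : Matrix ι ι ℝ} (hN : N.PosSemidef)
    (x : ι → ℝ) : x ⬝ᵥ (N *ᵥ x) ≤ N.trace * (x ⬝ᵥ x) := by
  obtain ⟨B, rfl⟩ := CStarAlgebra.nonneg_iff_eq_star_mul_self.mp hN.nonneg
  rw [star_eq_conjTranspose]
  have h1 : x ⬝ᵥ ((Bᴴ * B) *ᵥ x) = ∑ i, (∑ j, B i j * x j) ^ 2 := by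
    rw [← mulVec_mulVec, dotProduct_mulVec, conjTranspose_eq_transpose_of_trivial,
      vecMul_transpose]
    simp [dotProduct, mulVec, pow_two]
  have h2 : (Bᴴ * B).trace = ∑ i, ∑ j, B i j ^ 2 := by
    rw [trace_mul_comm]
    simp [trace, mul_apply, pow_two]
  rw [h1, h2, Finset.sum_mul]
  refine Finset.sum_le_sum fun i _ => (Finset.sum_mul_sq_le_sq_mul_sq _ _ _).trans_eq ?_
  simp [dotProduct, pow_two]

lemma posSemidef_sub_one_of_trace_inv_le {M : Matrix ι ι ℝ} (hM : M.PosDef)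
    (h : (M⁻¹).trace ≤ 1) : (M - 1).PosSemidef := by
  refine .of_dotProduct_mulVec_nonneg (hM.isHermitian.sub isHermitian_one) fun x => ?_
  have h1 := hM.dotProduct_sq_le x x
  have h2 := hM.inv.posSemidef.dotProduct_mulVec_le_trace x
  have h3 := hM.posSemidef.dotProduct_mulVec_nonneg x
  have h4 : 0 ≤ x ⬝ᵥ x := by simpa using dotProduct_star_self_nonneg x
  rw [star_trivial] at h3 ⊢
  simp only [sub_mulVec, one_mulVec, dotProduct_sub]
  rcases h4.eq_or_lt with h5 | h5
  · rw [← h5]; linarith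
  · have h6 : x ⬝ᵥ M⁻¹ *ᵥ x ≤ x ⬝ᵥ x := by nlinarith
    have h7 : (x ⬝ᵥ x) * (x ⬝ᵥ x) ≤ (x ⬝ᵥ x) * (x ⬝ᵥ M *ᵥ x) := by
      nlinarith
    have := le_of_mul_le_mul_left h7 h5
    linarith

lemma posDef_sub_quarter {M : Matrix ι ι ℝ} (hM : M.PosDef) (h : (M - 1).PosSemidef) :
    (M - (1 / 4 : ℝ) • (1 : Matrix ι ι ℝ)).PosDef ∧
      ((M - (1 / 4 : ℝ) • (1 : Matrix ι ι ℝ))⁻¹).trace ≤ 2 * (M⁻¹).trace := by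
  have hN : (M - (1 / 4 : ℝ) • (1 : Matrix ι ι ℝ)).PosDef := by
    have := PosDef.posSemidef_add h (PosDef.one.smul (show (0 : ℝ) < 3 / 4 by norm_num))
    convert this using 1
    module
  refine ⟨hN, ?_⟩
  generalize hNdef : M - (1 / 4 : ℝ) • (1 : Matrix ι ι ℝ) = N at *
  have hd := (isUnit_iff_isUnit_det _).1 hM.isUnit
  have hd' := (isUnit_iff_isUnit_det _).1 hN.isUnit
  have hX : ((M - 1) + (1 / 4 : ℝ) • (1 : Matrix ι ι ℝ) + (1 / 8 : ℝ) • M⁻¹).PosSemidef :=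
    (h.add (PosSemidef.one.smul (by norm_num))).add (hM.inv.posSemidef.smul (by norm_num))
  have hc := (hX.conjTranspose_mul_mul_same N⁻¹).trace_nonneg
  rw [hN.inv.isHermitian] at hc
  have hid : N⁻¹ * ((M - 1) + (1 / 4 : ℝ) • (1 : Matrix ι ι ℝ) + (1 / 8 : ℝ) • M⁻¹) * N⁻¹ =
      (2 : ℝ) • M⁻¹ - N⁻¹ := by
    have e : (M - 1) + (1 / 4 : ℝ) • (1 : Matrix ι ι ℝ) + (1 / 8 : ℝ) • M⁻¹ =
        N * ((2 : ℝ) • M⁻¹ - N⁻¹) * N := by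
      rw [mul_sub, sub_mul, mul_nonsing_inv _ hd', one_mul, ← hNdef]
      simp only [sub_mul, mul_sub, mul_smul_comm, smul_mul_assoc, mul_one, one_mul,
        mul_nonsing_inv _ hd, nonsing_inv_mul _ hd]
      module
    rw [e, mul_assoc, mul_nonsing_inv_cancel_right _ _ hd', nonsing_inv_mul_cancel_left _ _ hd']
  rw [hid, trace_sub, trace_smul, smul_eq_mul] at hc
  linarith

end RankOneBarrier

section TwoSidedBarrier

open Matrix

variable {ι κ : Type*} [Fintype ι] [DecidableEq ι] [Fintype κ]

lemma sum_dotProduct_mulVec_eq_trace {v : κ → ι → ℝ} (hv : ∑ i, vecMulVec (v i) (v i) = 1)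
    (X : Matrix ι ι ℝ) : ∑ i, v i ⬝ᵥ (X *ᵥ v i) = X.trace := by
  calc ∑ i, v i ⬝ᵥ (X *ᵥ v i) = ∑ i, (X * vecMulVec (v i) (v i)).trace := by
        refine Finset.sum_congr rfl fun i _ => ?_
        rw [mul_vecMulVec, trace_vecMulVec, dotProduct_comm]
    _ = X.trace := by rw [← trace_sum, ← Finset.mul_sum, hv, mul_one]

/-- `A` lies strictly between the barriers `l` and `u`, and both barrier potentials are at
most `1`. -/
structure WithinBarriers (A : Matrix ι ι ℝ) (l u : ℝ) : Prop where
  upper_posDef : (u • (1 : Matrix ι ι ℝ) - A).PosDef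
  lower_posDef : (A - l • (1 : Matrix ι ι ℝ)).PosDef
  upper_trace : ((u • (1 : Matrix ι ι ℝ) - A)⁻¹).trace ≤ 1
  lower_trace : ((A - l • (1 : Matrix ι ι ℝ))⁻¹).trace ≤ 1

/-- The Batson–Spielman–Srivastava step: some rank-one update allows both barriers to be moved
up without increasing the potentials. -/
lemma WithinBarriers.exists_step [Nonempty ι] {v : κ → ι → ℝ}
    (hv : ∑ i, vecMulVec (v i) (v i) = 1) {A : Matrix ι ι ℝ} {l u : ℝ}
    (h : WithinBarriers A l u) :
    ∃ i, ∃ t : ℝ, 0 ≤ t ∧ WithinBarriers (A + t • vecMulVec (v i) (v i)) (l + 1 / 4) (u + 2) := by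
  obtain ⟨hU, hL, hUt, hLt⟩ := h
  obtain ⟨hL', hLt'⟩ := posDef_sub_quarter hL (posSemidef_sub_one_of_trace_inv_le hL hLt)
  have hU' := hU.add_smul_one (δ := 2) (by norm_num)
  have hUd := le_trace_inv_sub_trace_inv hU (δ := 2) (by norm_num)
  have hLd := trace_inv_sub_trace_inv_le hL' (δ := 1 / 4) (by norm_num)
  have hLd0 := le_trace_inv_sub_trace_inv hL' (δ := 1 / 4) (by norm_num)
  rw [sub_add_cancel] at hLd hLd0
  have hLs := hL.mul_self_inv.trace_pos
  have hUs := hU'.mul_self_inv.trace_pos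
  have eL : A - l • (1 : Matrix ι ι ℝ) - (1 / 4 : ℝ) • 1 = A - (l + 1 / 4) • 1 := by module
  have eU : u • (1 : Matrix ι ι ℝ) - A + (2 : ℝ) • 1 = (u + 2) • 1 - A := by module
  rw [eL] at hL' hLt' hLd hLd0
  rw [eU] at hU' hUd hUs
  set ML := A - (l + 1 / 4) • (1 : Matrix ι ι ℝ) with hML
  set MU := (u + 2) • (1 : Matrix ι ι ℝ) - A with hMU
  set DU := ((u • (1 : Matrix ι ι ℝ) - A)⁻¹).trace - (MU⁻¹).trace with hDU
  set DL := (ML⁻¹).trace - ((A - l • (1 : Matrix ι ι ℝ))⁻¹).trace with hDL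
  have hDUpos : 0 < DU := by linarith
  have hDLpos : 0 < DL := by linarith
  have hsum : ∑ i, ((v i ⬝ᵥ ((MU⁻¹ * MU⁻¹) *ᵥ v i)) / DU + v i ⬝ᵥ (MU⁻¹ *ᵥ v i)) <
      ∑ i, ((v i ⬝ᵥ ((ML⁻¹ * ML⁻¹) *ᵥ v i)) / DL - v i ⬝ᵥ (ML⁻¹ *ᵥ v i)) := by
    rw [Finset.sum_add_distrib, Finset.sum_sub_distrib, ← Finset.sum_div, ← Finset.sum_div]
    simp only [sum_dotProduct_mulVec_eq_trace hv]
    have h1 : (MU⁻¹ * MU⁻¹).trace / DU ≤ 1 / 2 := by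
      rw [div_le_iff₀ hDUpos]; linarith
    have h2 : 4 ≤ (ML⁻¹ * ML⁻¹).trace / DL := by
      rw [le_div_iff₀ hDLpos]; linarith
    linarith
  obtain ⟨i, -, hi⟩ := Finset.exists_lt_of_sum_lt hsum
  have nn {N : Matrix ι ι ℝ} (hN : N.PosDef) : 0 ≤ v i ⬝ᵥ (N *ᵥ v i) := by
    simpa using hN.posSemidef.dotProduct_mulVec_nonneg (v i)
  have a1 := nn hU'.inv
  have a2 := nn hU'.mul_self_inv
  have b1 := nn hL'.inv
  have b2 := nn hL'.mul_self_inv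
  set qU := v i ⬝ᵥ (MU⁻¹ *ᵥ v i) with hqU
  set sU := v i ⬝ᵥ ((MU⁻¹ * MU⁻¹) *ᵥ v i) with hsU
  set qL := v i ⬝ᵥ (ML⁻¹ *ᵥ v i) with hqL
  set sL := v i ⬝ᵥ ((ML⁻¹ * ML⁻¹) *ᵥ v i) with hsL
  have hR : 0 < sL / DL - qL := lt_of_le_of_lt (by positivity) hi
  obtain ⟨R, hRdef⟩ : ∃ R, R = sL / DL - qL := ⟨_, rfl⟩
  rw [← hRdef] at hi hR
  have hsL' : sL = DL * (R + qL) := by rw [hRdef]; field_simp; ring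
  have hsU' : sU ≤ DU * (R - qU) := by
    have : sU / DU ≤ R - qU := by linarith
    rw [div_le_iff₀ hDUpos] at this; linarith
  have hqR : qU < R := by
    have : 0 ≤ sU / DU := by positivity
    rcases this.eq_or_lt with h0 | h0 <;> linarith
  refine ⟨i, R⁻¹, by positivity, ?_⟩
  have pU : 0 < 1 + -R⁻¹ * qU := by
    have : R⁻¹ * qU < 1 := by rw [inv_mul_lt_iff₀ hR]; linarith
    linarith
  have pL : 0 < 1 + R⁻¹ * qL := by positivity
  obtain ⟨cU, cU'⟩ := hU'.add_smul_vecMulVec (v i) pU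
  obtain ⟨cL, cL'⟩ := hL'.add_smul_vecMulVec (v i) pL
  have fU : MU + -R⁻¹ • vecMulVec (v i) (v i) =
      (u + 2) • (1 : Matrix ι ι ℝ) - (A + R⁻¹ • vecMulVec (v i) (v i)) := by
    rw [hMU]; module
  have fL : ML + R⁻¹ • vecMulVec (v i) (v i) =
      (A + R⁻¹ • vecMulVec (v i) (v i)) - (l + 1 / 4) • (1 : Matrix ι ι ℝ) := by
    rw [hML]; module
  rw [fU] at cU cU'
  rw [fL] at cL cL'
  refine ⟨cU, cL, ?_, ?_⟩
  · rw [cU', ← hqU, ← hsU]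
    have : -R⁻¹ * sU / (1 + -R⁻¹ * qU) = -(sU / (R - qU)) := by
      have : R - qU ≠ 0 := by linarith
      have : 1 + -R⁻¹ * qU = (R - qU) / R := by field_simp; ring
      rw [this]; field_simp
    have h3 : sU / (R - qU) ≤ DU := by rw [div_le_iff₀ (by linarith)]; exact hsU'
    rw [this]; linarith
  · rw [cL', ← hqL, ← hsL]
    have : R⁻¹ * sL / (1 + R⁻¹ * qL) = DL := by
      rw [hsL']
      have : R + qL ≠ 0 := by positivity
      have : 1 + R⁻¹ * qL = (R + qL) / R := by field_simp
      rw [this]; field_simp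
    rw [this]; linarith

lemma exists_weights_withinBarriers [Nonempty ι] {v : κ → ι → ℝ}
    (hv : ∑ i, vecMulVec (v i) (v i) = 1) (T : ℕ) :
    ∃ s : κ → ℝ, (∀ i, 0 ≤ s i) ∧ #{i | s i ≠ 0} ≤ T ∧
      WithinBarriers (∑ i, s i • vecMulVec (v i) (v i))
        (-(Fintype.card ι : ℝ) + T * (1 / 4)) (Fintype.card ι + T * 2) := by
  classical
  induction T with
  | zero =>
    have hk : (0 : ℝ) < Fintype.card ι := by exact_mod_cast Fintype.card_pos
    have hp := (PosDef.one (n := ι) (R := ℝ)).smul hk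
    have ht : (((Fintype.card ι : ℝ) • (1 : Matrix ι ι ℝ))⁻¹).trace ≤ 1 := by
      have : ((Fintype.card ι : ℝ) • (1 : Matrix ι ι ℝ))⁻¹ = (Fintype.card ι : ℝ)⁻¹ • 1 := by
        apply inv_eq_right_inv
        rw [smul_mul_smul_comm, mul_inv_cancel₀ hk.ne', one_smul, one_mul]
      rw [this, trace_smul, trace_one, smul_eq_mul, inv_mul_cancel₀ hk.ne']
    exact ⟨0, by simp, by simp, by simpa using hp, by simpa using hp, by simpa using ht,
      by simpa using ht⟩
  | succ T ih =>
    obtain ⟨s, hs, hc, hb⟩ := ih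
    obtain ⟨i, t, ht, hb'⟩ := hb.exists_step hv
    refine ⟨s + Pi.single i t, fun j => add_nonneg (hs j) ?_, ?_, ?_⟩
    · by_cases hij : j = i
      · subst hij; simpa using ht
      · simp [hij]
    · refine (Finset.card_le_card (t := insert i ({j | s j ≠ 0} : Finset κ)) fun j hj => ?_).trans
        ((Finset.card_insert_le _ _).trans (by omega))
      by_cases hij : j = i
      · simp [hij]
      · simpa [hij] using hj
    · convert hb' using 1
      · simp [add_smul, Finset.sum_add_distrib, Pi.single_apply]
      · push_cast; ring
      · push_cast; ring

/-- A decomposition of the identity into rank-one matrices can be reweighted, keeping at most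
`8 * card ι` terms, so that the result stays between `1` and `17`. -/
lemma exists_sparse_weights {v : κ → ι → ℝ} (hv : ∑ i, vecMulVec (v i) (v i) = 1) :
    ∃ s : κ → ℝ, (∀ i, 0 ≤ s i) ∧ #{i | s i ≠ 0} ≤ 8 * Fintype.card ι ∧
      ∀ y : ι → ℝ, y ⬝ᵥ y ≤ ∑ i, s i * (v i ⬝ᵥ y) ^ 2 ∧
        ∑ i, s i * (v i ⬝ᵥ y) ^ 2 ≤ 17 * (y ⬝ᵥ y) := by
  rcases isEmpty_or_nonempty ι with hι | hι
  · exact ⟨0, by simp, by simp, fun y => by simp [dotProduct]⟩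
  obtain ⟨s, hs, hc, hb⟩ := exists_weights_withinBarriers hv (8 * Fintype.card ι)
  have hk : (0 : ℝ) < Fintype.card ι := by exact_mod_cast Fintype.card_pos
  refine ⟨fun i => (Fintype.card ι : ℝ)⁻¹ * s i, fun i => mul_nonneg (by positivity) (hs i), ?_,
    fun y => ?_⟩
  · simpa [hk.ne'] using hc
  · have hA : y ⬝ᵥ ((∑ i, s i • vecMulVec (v i) (v i)) *ᵥ y) = ∑ i, s i * (v i ⬝ᵥ y) ^ 2 := by
      simp only [sum_mulVec, dotProduct_sum, smul_mulVec, vecMulVec_mulVec, dotProduct_smul,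
        op_smul_eq_smul, smul_eq_mul, dotProduct_comm y (v _), pow_two]
    have hu := hb.upper_posDef.posSemidef.dotProduct_mulVec_nonneg y
    have hl := hb.lower_posDef.posSemidef.dotProduct_mulVec_nonneg y
    simp only [star_trivial, sub_mulVec, smul_mulVec, one_mulVec, dotProduct_sub, dotProduct_smul,
      smul_eq_mul, hA] at hu hl
    push_cast at hu hl
    simp only [mul_assoc, ← Finset.mul_sum]
    rw [le_inv_mul_iff₀ hk, inv_mul_le_iff₀ hk]
    constructor <;> linarith

end TwoSidedBarrier

/-- A sum of squares of linear functionals on `V → ℝ` can be reweighted, keeping at most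
`8 * card V` of them, with distortion at most `17`. -/
lemma exists_sparse_reweighting {E V : Type*} [Fintype E] [Fintype V]
    (f : E → (V → ℝ) →ₗ[ℝ] ℝ) :
    ∃ s : E → ℝ, (∀ e, 0 ≤ s e) ∧ #{e | s e ≠ 0} ≤ 8 * Fintype.card V ∧
      ∀ x : V → ℝ, ∑ e, f e x ^ 2 ≤ ∑ e, s e * f e x ^ 2 ∧
        ∑ e, s e * f e x ^ 2 ≤ 17 * ∑ e, f e x ^ 2 := by
  let Φ : (V → ℝ) →ₗ[ℝ] EuclideanSpace ℝ E :=
    (WithLp.linearEquiv 2 ℝ (E → ℝ)).symm.toLinearMap ∘ₗ LinearMap.pi f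
  let b := stdOrthonormalBasis ℝ (LinearMap.range Φ)
  let v : E → Fin (Module.finrank ℝ (LinearMap.range Φ)) → ℝ :=
    fun e j => (b j : EuclideanSpace ℝ E) e
  have hv : ∑ e, Matrix.vecMulVec (v e) (v e) = 1 := by
    ext j l
    have h := orthonormal_iff_ite.1 b.orthonormal l j
    rw [Submodule.coe_inner, PiLp.inner_apply] at h
    simpa [Matrix.sum_apply, Matrix.vecMulVec_apply, v, Matrix.one_apply, eq_comm] using h
  obtain ⟨s, hs, hc, h⟩ := exists_sparse_weights hv
  refine ⟨s, hs, hc.trans ?_, fun x => ?_⟩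
  · have := LinearMap.finrank_range_le Φ
    simp only [Module.finrank_fintype_fun_eq_card] at this
    simpa using this
  · let z : LinearMap.range Φ := ⟨Φ x, LinearMap.mem_range_self Φ x⟩
    have hf : ∀ e, v e ⬝ᵥ (b.repr z).ofLp = f e x := by
      intro e
      have h1 := congrArg (fun w : LinearMap.range Φ => (w : EuclideanSpace ℝ E) e) (b.sum_repr z)
      simp only [AddSubmonoidClass.coe_finsetSum, WithLp.ofLp_sum, Finset.sum_apply] at h1
      have h2 : (z : EuclideanSpace ℝ E) e = f e x := rfl
      rw [← h2, ← h1]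
      exact Finset.sum_congr rfl fun j _ => mul_comm _ _
    have hn : (b.repr z).ofLp ⬝ᵥ (b.repr z).ofLp = ∑ e, f e x ^ 2 := by
      have h1 : ‖b.repr z‖ ^ 2 = ‖(z : EuclideanSpace ℝ E)‖ ^ 2 := by
        rw [LinearIsometryEquiv.norm_map]; rfl
      rw [EuclideanSpace.real_norm_sq_eq, EuclideanSpace.real_norm_sq_eq] at h1
      calc _ = ∑ j, b.repr z j ^ 2 := by simp [dotProduct, pow_two]
        _ = _ := h1
    have := h (b.repr z).ofLp
    simpa only [hf, hn] using this

/-- Every weighted graph has a spectral sparsifier of distortion `17` with at most `8 * card V`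
edges. -/
lemma exists_linear_size_sparsifier {V : Type*} [Fintype V] (w : V → V → ℝ)
    (hsymm : ∀ u v, w u v = w v u) (hnn : ∀ u v, 0 ≤ w u v) :
    ∃ w' : V → V → ℝ, (∀ u v, w' u v = w' v u) ∧ (∀ u v, 0 ≤ w' u v) ∧
      (∀ u v, w u v = 0 → w' u v = 0) ∧
      #{p : V × V | w' p.1 p.2 ≠ 0} ≤ 16 * Fintype.card V ∧
      ∀ x, lapForm w x ≤ lapForm w' x ∧ lapForm w' x ≤ 17 * lapForm w x := by
  let f : V × V → (V → ℝ) →ₗ[ℝ] ℝ := fun p =>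
    √(w p.1 p.2 / 2) • ((LinearMap.proj p.1 : (V → ℝ) →ₗ[ℝ] ℝ) - LinearMap.proj p.2)
  have hf : ∀ p x, f p x ^ 2 = w p.1 p.2 / 2 * (x p.1 - x p.2) ^ 2 := by
    intro p x
    have : 0 ≤ w p.1 p.2 / 2 := div_nonneg (hnn _ _) zero_le_two
    simp only [f, LinearMap.smul_apply, LinearMap.sub_apply, LinearMap.proj_apply, smul_eq_mul,
      mul_pow, Real.sq_sqrt this]
  obtain ⟨s, hs, hc, h⟩ := exists_sparse_reweighting f
  refine ⟨fun u v => w u v * ((s (u, v) + s (v, u)) / 2), fun u v => ?_, fun u v => ?_,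
    fun u v huv => by simp [huv], ?_, fun x => ?_⟩
  · beta_reduce
    rw [hsymm u v, add_comm]
  · have := hs (u, v)
    have := hs (v, u)
    have := hnn u v
    positivity
  · have hsub : ({p : V × V | w p.1 p.2 * ((s (p.1, p.2) + s (p.2, p.1)) / 2) ≠ 0} : Finset _) ⊆
        ({p | s p ≠ 0} : Finset (V × V)) ∪ ({p | s p ≠ 0} : Finset (V × V)).image Prod.swap := by
      rintro ⟨u, v⟩ hp
      simp only [Finset.mem_filter_univ, Finset.mem_union, Finset.mem_image, Prod.exists,
        Prod.swap_prod_mk, Prod.mk.injEq] at hp ⊢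
      by_contra! hcon
      have h1 := hcon.1
      have h2 : s (v, u) = 0 := by
        by_contra h2
        exact hcon.2 v u h2 rfl rfl
      simp [h1, h2] at hp
    have h1 := Finset.card_le_card hsub
    have h2 := Finset.card_union_le ({p | s p ≠ 0} : Finset (V × V))
      (({p | s p ≠ 0} : Finset (V × V)).image Prod.swap)
    have h3 := Finset.card_image_le (s := ({p | s p ≠ 0} : Finset (V × V))) (f := Prod.swap)
    beta_reduce
    omega
  · have e1 : lapForm w x = ∑ p, f p x ^ 2 := by
      simp only [hf, lapForm, Finset.mul_sum, Fintype.sum_prod_type]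
      exact Finset.sum_congr rfl fun u _ => Finset.sum_congr rfl fun v _ => by ring
    have e2 : lapForm (fun u v => w u v * ((s (u, v) + s (v, u)) / 2)) x =
        ∑ p, s p * f p x ^ 2 := by
      simp only [hf, lapForm, Finset.mul_sum, Fintype.sum_prod_type]
      have e3 : ∑ u, ∑ v, s (u, v) * (w u v / 2 * (x u - x v) ^ 2) =
          ∑ u, ∑ v, s (v, u) * (w u v / 2 * (x u - x v) ^ 2) := by
        rw [Finset.sum_comm]
        refine Finset.sum_congr rfl fun u _ => Finset.sum_congr rfl fun v _ => ?_
        rw [hsymm v u]; ring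
      have e4 : ∑ u, ∑ v, 1 / 2 * (w u v * ((s (u, v) + s (v, u)) / 2) * (x u - x v) ^ 2) =
          1 / 2 * (∑ u, ∑ v, s (u, v) * (w u v / 2 * (x u - x v) ^ 2)) +
          1 / 2 * ∑ u, ∑ v, s (v, u) * (w u v / 2 * (x u - x v) ^ 2) := by
        simp only [Finset.mul_sum, ← Finset.sum_add_distrib]
        exact Finset.sum_congr rfl fun u _ => Finset.sum_congr rfl fun v _ => by ring
      rw [e4, ← e3]; ring
    rw [e1, e2]
    exact h x

lemma lapForm_nonneg {V : Type*} [Fintype V] {w : V → V → ℝ} (hnn : ∀ u v, 0 ≤ w u v)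
    (x : V → ℝ) : 0 ≤ lapForm w x :=
  mul_nonneg (by norm_num) (Finset.sum_nonneg fun u _ => Finset.sum_nonneg fun v _ =>
    mul_nonneg (hnn u v) (sq_nonneg _))

lemma three_halves_le_logb_two {m : ℕ} (hm : 3 ≤ m) : 3 / 2 ≤ Real.logb 2 m := by
  have hm' : (3 : ℝ) ≤ m := by exact_mod_cast hm
  have h : (3 : ℝ) ≤ Real.logb 2 ((m : ℝ) ^ 2) := by
    rw [Real.le_logb_iff_rpow_le one_lt_two (by positivity)]
    norm_num
    nlinarith
  rw [Real.logb_pow] at h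
  push_cast at h
  linarith

lemma one_le_logb_two {n : ℕ} (hn : 2 ≤ n) : 1 ≤ Real.logb 2 n := by
  have hn' : (2 : ℝ) ≤ n := by exact_mod_cast hn
  rw [Real.le_logb_iff_rpow_le one_lt_two (by positivity)]
  simpa using hn'

/-- deterministic spectral sparsification — for every weighted
graph `G` on `n ≥ 2` vertices with `m ≥ 2` edges (given by a symmetric integer
weight function `w` with zero diagonal; an edge is a pair of distinct vertices
of nonzero weight, so the number of ordered nonzero pairs is `2m`) whose weights
are at most `U`, there is a nonnegatively weighted graph `H` on the same vertex
set with at most `c·n·log₂ n·log₂ U` edges (i.e. at most `2·c·n·log₂ n·log₂ U`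
ordered nonzero pairs) that is an `α`-approximate spectral sparsifier of `G`,
where `α = (log₂ m)^(c·r²)`. -/
theorem spectral_sparsifier_exists :
    ∃ c : ℕ, 1 ≤ c ∧
      ∀ (V : Type) [Fintype V] [DecidableEq V] (w : V → V → ℕ) (m U r : ℕ),
        2 ≤ Fintype.card V →
        (∀ u v, w u v = w v u) → (∀ v, w v v = 0) →
        2 * m = ((Finset.univ ×ˢ Finset.univ).filter
          fun p : V × V => w p.1 p.2 ≠ 0).card →
        2 ≤ m → 2 ≤ U → (∀ u v, w u v ≤ U) → 1 ≤ r →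
        ∃ w' : V → V → ℝ,
          (∀ u v, w' u v = w' v u) ∧ (∀ u v, 0 ≤ w' u v) ∧ (∀ v, w' v v = 0) ∧
          ((((Finset.univ ×ˢ Finset.univ).filter
              fun p : V × V => w' p.1 p.2 ≠ 0).card : ℝ) ≤
            2 * (c : ℝ) * (Fintype.card V : ℝ) *
              Real.logb 2 (Fintype.card V) * Real.logb 2 U) ∧
          ∀ x : V → ℝ,
            (1 / Real.logb 2 m ^ (c * r ^ 2)) * lapForm (fun u v => (w u v : ℝ)) x ≤
                lapForm w' x ∧
              lapForm w' x ≤ Real.logb 2 m ^ (c * r ^ 2) * lapForm (fun u v => (w u v : ℝ)) x := by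
  refine ⟨8, by norm_num, ?_⟩
  intro V _ _ w m U r hV hsymm hdiag hm hm2 hU _ hr
  have hnV := one_le_logb_two hV
  have hnU := one_le_logb_two hU
  have hsize : (16 : ℝ) * Fintype.card V ≤ 2 * ((8 : ℕ) : ℝ) * (Fintype.card V : ℝ) *
      Real.logb 2 (Fintype.card V) * Real.logb 2 U := by
    have h1 : (1 : ℝ) ≤ Real.logb 2 (Fintype.card V) * Real.logb 2 U := by nlinarith
    have h2 : (0 : ℝ) ≤ 16 * Fintype.card V := by positivity
    push_cast
    nlinarith
  have hnn : ∀ u v, (0 : ℝ) ≤ w u v := fun u v => Nat.cast_nonneg _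
  rcases hm2.eq_or_lt with rfl | hm3
  · refine ⟨fun u v => w u v, fun u v => by beta_reduce; rw [hsymm], hnn, fun v => by simp [hdiag], ?_,
      fun x => by simp⟩
    refine le_trans ?_ hsize
    simp only [Nat.cast_ne_zero]
    have hV' : (2 : ℝ) ≤ Fintype.card V := by exact_mod_cast hV
    calc _ = ((2 * 2 : ℕ) : ℝ) := by rw [hm]
      _ ≤ _ := by push_cast; linarith
  · obtain ⟨w', h1, h2, h3, h4, h5⟩ := exists_linear_size_sparsifier (fun u v => (w u v : ℝ))
      (fun u v => by rw [hsymm]) hnn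
    have hlog := three_halves_le_logb_two hm3
    have hα : (17 : ℝ) ≤ Real.logb 2 m ^ (8 * r ^ 2) := by
      calc (17 : ℝ) ≤ (3 / 2) ^ 8 := by norm_num
        _ ≤ Real.logb 2 m ^ 8 := by gcongr
        _ ≤ _ := pow_le_pow_right₀ (by linarith) (Nat.le_mul_of_pos_right _ (by positivity))
    refine ⟨w', h1, h2, fun v => h3 v v (by simp [hdiag]), ?_, fun x => ?_⟩
    · refine le_trans ?_ hsize
      rw [Finset.univ_product_univ]
      exact_mod_cast h4
    · have h0 := lapForm_nonneg hnn x
      refine ⟨le_trans (mul_le_of_le_one_left h0 ?_) (h5 x).1, (h5 x).2.trans (by gcongr)⟩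
      rw [div_le_one (by linarith)]
      linarith
end

section
/- There is a universal constant c ≥ 1 such that the following holds. Let G be a graph with m ≥ 2 edges, let ε ∈ (0,1], and let r ≥ 1 be an integer. Then there exists a partition {V₁,…,V_k} of V(G) such that for every i the induced subgraph G[V_i] has conductance Φ(G[V_i]) ≥ ε/(c·(log₂ m)^{c·r²}), and Σ_{i=1}^k |E_G(V_i, V(G)∖V_i)| ≤ ε·Vol(G). -/
open Finset
open scoped Classical

variable {V : Type*}

/-- The degree of a vertex. -/
noncomputable def deg [Fintype V] (G : SimpleGraph V) (v : V) : ℕ :=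
  (Finset.univ.filter fun u => G.Adj v u).card

/-- The volume of a vertex set: the sum of the degrees of its vertices. -/
noncomputable def vol [Fintype V] (G : SimpleGraph V) (S : Finset V) : ℕ :=
  ∑ v ∈ S, deg G v

/-- The degree of `v` inside the induced subgraph `G[U]`. -/
noncomputable def degWithin (G : SimpleGraph V) (U : Finset V) (v : V) : ℕ :=
  (U.filter fun u => G.Adj v u).card

/-- The volume of `S` inside the induced subgraph `G[U]`. -/
noncomputable def volWithin (G : SimpleGraph V) (U S : Finset V) : ℕ :=
  ∑ v ∈ S, degWithin G U v

/-- The induced subgraph `G[U]` has conductance at least `φ`. -/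
def conductanceGe (G : SimpleGraph V) (U : Finset V) (φ : ℝ) : Prop :=
  ∀ S ⊆ U, S.Nonempty → (U \ S).Nonempty →
    φ * ((min (volWithin G U S) (volWithin G U (U \ S)) : ℕ) : ℝ) ≤
      (interEdges G S (U \ S) : ℝ)

section InterEdges

variable (G : SimpleGraph V)

theorem interEdges_eq_volWithin (A B : Finset V) : interEdges G A B = volWithin G B A := by
  simp only [interEdges, volWithin, degWithin, card_filter, sum_product]

theorem interEdges_comm (A B : Finset V) : interEdges G A B = interEdges G B A := by
  simp only [interEdges, card_filter, sum_product]
  rw [sum_comm]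
  simp only [G.adj_comm]

theorem interEdges_union_left {A B : Finset V} (h : Disjoint A B) (C : Finset V) :
    interEdges G (A ∪ B) C = interEdges G A C + interEdges G B C := by
  simp only [interEdges_eq_volWithin, volWithin, sum_union h]

theorem interEdges_union_right (A : Finset V) {B C : Finset V} (h : Disjoint B C) :
    interEdges G A (B ∪ C) = interEdges G A B + interEdges G A C := by
  simp only [interEdges_comm G A, interEdges_union_left G h]

theorem interEdges_biUnion_left {𝒜 : Finset (Finset V)}
    (h : (𝒜 : Set (Finset V)).PairwiseDisjoint id) (C : Finset V) :
    interEdges G (𝒜.biUnion id) C = ∑ A ∈ 𝒜, interEdges G A C := by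
  simp only [interEdges_eq_volWithin, volWithin, sum_biUnion h, id]

/-- Refining one side of a cut: the boundaries inside `S ∪ T` of the parts of a partition of `S`
add up to the boundaries inside `S` plus the edges of the cut. -/
theorem sum_interEdges_sdiff_union {𝒜 : Finset (Finset V)} {S T : Finset V}
    (h𝒜 : (𝒜 : Set (Finset V)).PairwiseDisjoint id) (hS : 𝒜.biUnion id = S)
    (hST : Disjoint S T) :
    ∑ A ∈ 𝒜, interEdges G A ((S ∪ T) \ A) =
      ∑ A ∈ 𝒜, interEdges G A (S \ A) + interEdges G S T := by
  rw [← hS, interEdges_biUnion_left G h𝒜, hS, ← sum_add_distrib]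
  refine sum_congr rfl fun A hA => ?_
  have hAS : A ⊆ S := hS ▸ subset_biUnion_of_mem id hA
  rw [union_sdiff_distrib, sdiff_eq_self_of_disjoint (hST.mono_left hAS).symm,
    interEdges_union_right G A (hST.mono_left sdiff_subset)]

end InterEdges

theorem vol_univ [Fintype V] (G : SimpleGraph V) : vol G univ = 2 * G.edgeSet.ncard := by
  rw [Set.ncard_eq_toFinset_card', ← SimpleGraph.edgeFinset, ← G.sum_degrees_eq_twice_card_edges]
  refine sum_congr rfl fun v _ => ?_
  rw [← G.card_neighborFinset_eq_degree, G.neighborFinset_eq_filter, deg]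

theorem natCast_mul_logb_mono {a b : ℕ} (h : a ≤ b) :
    (a : ℝ) * Real.logb 2 a ≤ b * Real.logb 2 b := by
  rcases a.eq_zero_or_pos with rfl | ha
  · rcases b.eq_zero_or_pos with rfl | hb
    · simp
    · simpa using mul_nonneg b.cast_nonneg
        (Real.logb_nonneg one_lt_two (Nat.one_le_cast.mpr hb))
  · have ha' : (1 : ℝ) ≤ a := Nat.one_le_cast.mpr ha
    have hab : (a : ℝ) ≤ b := Nat.cast_le.mpr h
    exact mul_le_mul hab (Real.logb_le_logb_of_le one_lt_two (by linarith) hab)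
      (Real.logb_nonneg one_lt_two ha') b.cast_nonneg

theorem mul_logb_add_le_of_le {a b : ℕ} (h : a ≤ b) :
    (a : ℝ) + (a * Real.logb 2 a + b * Real.logb 2 b) ≤ (a + b : ℕ) * Real.logb 2 (a + b : ℕ) := by
  rcases a.eq_zero_or_pos with rfl | ha
  · simp
  · have ha' : (0 : ℝ) < a := Nat.cast_pos.mpr ha
    have hab : (a : ℝ) ≤ b := Nat.cast_le.mpr h
    have h₁ : 1 + Real.logb 2 a ≤ Real.logb 2 (a + b : ℕ) := by
      have : Real.logb 2 (2 * a) = 1 + Real.logb 2 a := by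
        rw [Real.logb_mul two_ne_zero ha'.ne', Real.logb_self_eq_one one_lt_two]
      rw [← this]
      exact Real.logb_le_logb_of_le one_lt_two (by positivity) (by push_cast; linarith)
    have h₂ : Real.logb 2 b ≤ Real.logb 2 (a + b : ℕ) :=
      Real.logb_le_logb_of_le one_lt_two (by linarith) (by push_cast; linarith)
    have h₃ := mul_le_mul_of_nonneg_left h₁ ha'.le
    have h₄ := mul_le_mul_of_nonneg_left h₂ (ha'.le.trans hab)
    rw [Nat.cast_add a b, add_mul, ← Nat.cast_add]
    linarith

theorem min_add_mul_logb_le (a b : ℕ) :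
    ((min a b : ℕ) : ℝ) + (a * Real.logb 2 a + b * Real.logb 2 b) ≤
      (a + b : ℕ) * Real.logb 2 (a + b : ℕ) := by
  rcases le_total a b with h | h
  · simpa only [min_eq_left h] using mul_logb_add_le_of_le h
  · rw [min_eq_right h, add_comm a b, add_comm ((a : ℝ) * _)]
    exact mul_logb_add_le_of_le h

/-- Recursively cutting along sparse cuts partitions `G[U]` into parts of conductance at least `φ`;
the cost of a cut is charged to its smaller side, so a vertex pays at most `log₂ (Vol G[U])` times. -/
theorem exists_partition_conductanceGe (G : SimpleGraph V) {φ : ℝ} (hφ : 0 ≤ φ) (U : Finset V) :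
    ∃ 𝒜 : Finset (Finset V),
      (∀ A ∈ 𝒜, A.Nonempty ∧ conductanceGe G A φ) ∧
      (𝒜 : Set (Finset V)).PairwiseDisjoint id ∧ 𝒜.biUnion id = U ∧
      ((∑ A ∈ 𝒜, interEdges G A (U \ A) : ℕ) : ℝ) ≤
        2 * φ * (volWithin G U U * Real.logb 2 (volWithin G U U)) := by
  induction U using Finset.strongInduction with
  | H U ih =>
  by_cases hU : conductanceGe G U φ
  · have hnn : 0 ≤ 2 * φ * (volWithin G U U * Real.logb 2 (volWithin G U U)) :=
      mul_nonneg (by positivity)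
        (by simpa using natCast_mul_logb_mono (Nat.zero_le (volWithin G U U)))
    rcases U.eq_empty_or_nonempty with rfl | hne
    · exact ⟨∅, by simp, by simp, by simp, by simpa using hnn⟩
    · exact ⟨{U}, by simp [hne, hU], by simp, by simp, by simpa [interEdges] using hnn⟩
  simp only [conductanceGe, not_forall, not_le] at hU
  obtain ⟨S, hSU, hS, hT, hcut⟩ := hU
  set T := U \ S with hTdef
  have hST : Disjoint S T := disjoint_sdiff
  have hUST : S ∪ T = U := union_sdiff_of_subset hSU
  obtain ⟨𝒜, h𝒜, h𝒜d, h𝒜U, h𝒜c⟩ := ih S (hSU.ssubset_of_ne fun h => by simp [hTdef, h] at hT)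
  obtain ⟨ℬ, hℬ, hℬd, hℬU, hℬc⟩ := ih T (sdiff_ssubset hSU hS)
  have hcross : ∀ A ∈ 𝒜, ∀ B ∈ ℬ, Disjoint A B := fun A hA B hB =>
    hST.mono (h𝒜U ▸ subset_biUnion_of_mem id hA) (hℬU ▸ subset_biUnion_of_mem id hB)
  have hdisj : Disjoint 𝒜 ℬ := disjoint_left.mpr fun A hA hA' =>
    (h𝒜 A hA).1.ne_empty (disjoint_self.mp (hcross A hA A hA'))
  refine ⟨𝒜 ∪ ℬ, ?_, ?_, by rw [union_biUnion, h𝒜U, hℬU, hUST], ?_⟩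
  · intro A hA
    exact (mem_union.mp hA).elim (h𝒜 A) (hℬ A)
  · rw [coe_union]
    exact Set.pairwiseDisjoint_union.mpr ⟨h𝒜d, hℬd, fun A hA B hB _ => hcross A hA B hB⟩
  have hcost : ∑ A ∈ 𝒜 ∪ ℬ, interEdges G A (U \ A) =
      ∑ A ∈ 𝒜, interEdges G A (S \ A) + ∑ A ∈ ℬ, interEdges G A (T \ A) +
        2 * interEdges G S T := by
    have h₁ := sum_interEdges_sdiff_union G h𝒜d h𝒜U hST
    have h₂ := sum_interEdges_sdiff_union G hℬd hℬU hST.symm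
    rw [hUST] at h₁
    rw [union_comm, hUST, interEdges_comm] at h₂
    rw [sum_union hdisj, h₁, h₂]
    ring
  have hvol : volWithin G U U = volWithin G U S + volWithin G U T := by
    conv_lhs => rw [← interEdges_eq_volWithin, ← hUST, interEdges_union_left G hST, hUST]
    simp only [interEdges_eq_volWithin]
  have hmono : ∀ A ⊆ U, volWithin G A A ≤ volWithin G U A := fun A hA =>
    sum_le_sum fun v _ => card_le_card (filter_subset_filter _ hA)
  have hSm := natCast_mul_logb_mono (hmono S hSU)
  have hTm := natCast_mul_logb_mono (hmono T sdiff_subset)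
  have hadd := min_add_mul_logb_le (volWithin G U S) (volWithin G U T)
  have key := mul_le_mul_of_nonneg_left
    ((add_le_add_right (add_le_add hSm hTm) _).trans hadd) (mul_nonneg zero_le_two hφ)
  rw [hcost, hvol]
  push_cast at *
  linarith

/-- existence of an `(ε, ε/(c·(log₂ m)^(c·r²)))`-expander
decomposition. -/
theorem expander_decomposition_exists :
    ∃ c : ℕ, 1 ≤ c ∧
      ∀ (V : Type) [Fintype V] [DecidableEq V] (G : SimpleGraph V) (ε : ℝ) (r : ℕ),
        2 ≤ G.edgeSet.ncard → 0 < ε → ε ≤ 1 → 1 ≤ r →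
        ∃ (k : ℕ) (P : Fin k → Finset V),
          (∀ i, (P i).Nonempty) ∧
          (∀ i j, i ≠ j → Disjoint (P i) (P j)) ∧
          Finset.univ.biUnion P = Finset.univ ∧
          (∀ i, conductanceGe G (P i)
            (ε / ((c : ℝ) * Real.logb 2 (G.edgeSet.ncard) ^ (c * r ^ 2)))) ∧
          ((∑ i, interEdges G (P i) (P i)ᶜ : ℕ) : ℝ) ≤ ε * (vol G Finset.univ : ℝ) := by
  refine ⟨4, by norm_num, ?_⟩
  intro V _ inst G ε r hm hε _ hr
  obtain rfl : inst = fun a b => Classical.propDecidable (a = b) := Subsingleton.elim _ _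
  set m := G.edgeSet.ncard
  set L := Real.logb 2 m with hL
  have hm0 : (0 : ℝ) < m := by exact_mod_cast (by omega : 0 < m)
  have hL1 : 1 ≤ L := by
    rw [hL, Real.le_logb_iff_rpow_le one_lt_two hm0, Real.rpow_one]
    exact_mod_cast hm
  set φ := ε / (((4 : ℕ) : ℝ) * L ^ (4 * r ^ 2)) with hφ
  have hφ0 : 0 ≤ φ := by positivity
  have hφL : 4 * φ * L ≤ ε := by
    have hpow : L ≤ L ^ (4 * r ^ 2) :=
      le_self_pow₀ hL1 (mul_ne_zero four_ne_zero (pow_ne_zero 2 (by omega)))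
    have hφε : φ * (4 * L ^ (4 * r ^ 2)) = ε := by
      rw [hφ]
      push_cast
      exact div_mul_cancel₀ ε (by positivity)
    nlinarith [mul_le_mul_of_nonneg_left hpow hφ0]
  obtain ⟨𝒜, h𝒜, hd, hcover, hcost⟩ := exists_partition_conductanceGe G hφ0 univ
  have hvol : volWithin G univ univ = 2 * m := vol_univ G
  have hlog : Real.logb 2 ((2 * m : ℕ) : ℝ) ≤ 2 * L := by
    rw [Nat.cast_mul, Nat.cast_two, Real.logb_mul two_ne_zero hm0.ne',
      Real.logb_self_eq_one one_lt_two]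
    linarith
  refine ⟨𝒜.card, fun i => 𝒜.equivFin.symm i, fun i => (h𝒜 _ (𝒜.equivFin.symm i).2).1, ?_, ?_,
    fun i => (h𝒜 _ (𝒜.equivFin.symm i).2).2, ?_⟩
  · intro i j hij
    exact hd (𝒜.equivFin.symm i).2 (𝒜.equivFin.symm j).2
      fun h => hij (𝒜.equivFin.symm.injective (Subtype.ext h))
  · rw [eq_univ_iff_forall]
    intro v
    obtain ⟨A, hA, hv⟩ := mem_biUnion.mp (hcover ▸ mem_univ v)
    exact mem_biUnion.mpr ⟨𝒜.equivFin ⟨A, hA⟩, mem_univ _, by simpa using hv⟩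
  · rw [𝒜.equivFin.symm.sum_comp (fun A => interEdges G (A : Finset V) (A : Finset V)ᶜ),
      sum_coe_sort 𝒜 (fun A => interEdges G A Aᶜ), vol_univ]
    simp only [compl_eq_univ_sdiff]
    rw [hvol] at hcost
    calc _ ≤ 2 * φ * ((2 * m : ℕ) * Real.logb 2 ((2 * m : ℕ) : ℝ)) := hcost
      _ ≤ 2 * φ * ((2 * m : ℕ) * (2 * L)) := by gcongr
      _ = 4 * φ * L * (2 * m : ℕ) := by ring
      _ ≤ ε * (2 * m : ℕ) := by gcongr
end
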